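/- For every integer N ≥ 1, pg(N) ≤ 4096^N, i.e., the number of plane graphs on any set of N points in the plane in general position is at most 4096^N. -/

import Mathlib

open scoped Classical

noncomputable section

/-- A point in the plane. -/
abbrev Pt : Type := ℝ × ℝ

/-- `S` is in general position: no three distinct points of `S` are collinear. -/
def GenPos (S : Finset Pt) : Prop :=
  ∀ p ∈ S, ∀ q ∈ S, ∀ r ∈ S, p ≠ q → p ≠ r → q ≠ r →
    ¬ Collinear ℝ ({p, q, r} : Set Pt)

/-- Two straight edges cross if their relative interiors (open segments) meet. -/
def EdgesCross (e f : Sym2 Pt) : Prop :=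
  ∃ a b c d : Pt, e = s(a, b) ∧ f = s(c, d) ∧
    (openSegment ℝ a b ∩ openSegment ℝ c d).Nonempty

/-- `G` is a crossing-free straight-edge (plane) graph on the point set `S`:
its edges are nondegenerate straight segments between points of `S`,
and no two distinct edges cross. -/
def IsPlaneGraph (S : Finset Pt) (G : Finset (Sym2 Pt)) : Prop :=
  (∀ e ∈ G, ¬ e.IsDiag ∧ ∀ p ∈ e, p ∈ S) ∧
    ∀ e ∈ G, ∀ f ∈ G, e ≠ f → ¬ EdgesCross e f

/-- The (finite) collection of all plane graphs on `S`. -/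
def planeGraphs (S : Finset Pt) : Finset (Finset (Sym2 Pt)) :=
  S.sym2.powerset.filter (IsPlaneGraph S)

/-- The degree of the point `p` in the graph `G`. -/
def vingDeg (G : Finset (Sym2 Pt)) (p : Pt) : ℕ :=
  (G.filter fun e => p ∈ e).card

/-- The ving `(p, G)` is an x-ving: no straight edge from `p` to another point
of `S` can be added to `G` while keeping the graph plane. -/
def IsXVing (S : Finset Pt) (G : Finset (Sym2 Pt)) (p : Pt) : Prop :=
  ∀ q ∈ S, q ≠ p → s(p, q) ∉ G → ¬ IsPlaneGraph S (insert s(p, q) G)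

/-- `v_x(G)`: the number of x-vings of `G`. -/
def vx (S : Finset Pt) (G : Finset (Sym2 Pt)) : ℕ :=
  (S.filter (IsXVing S G)).card

/-- `v_i(G)`: the number of vertices of degree exactly `i` in `G`. -/
def vdeg (S : Finset Pt) (G : Finset (Sym2 Pt)) (i : ℕ) : ℕ :=
  (S.filter fun p => vingDeg G p = i).card

/-- `ĥv_x(S)`: the average of `v_x(G)` over a uniformly random plane graph on `S`. -/
def hvx (S : Finset Pt) : ℝ :=
  (∑ G ∈ planeGraphs S, (vx S G : ℝ)) / (planeGraphs S).card

/-- `ĥv_i(S)`: the average of `v_i(G)` over a uniformly random plane graph on `S`. -/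
def hvdeg (S : Finset Pt) (i : ℕ) : ℝ :=
  (∑ G ∈ planeGraphs S, (vdeg S G i : ℝ)) / (planeGraphs S).card

/-- `pg(N)`: the maximum number of plane graphs over all sets of `N` points in
general position. -/
def pgMax (N : ℕ) : ℕ :=
  sSup {n : ℕ | ∃ S : Finset Pt, S.card = N ∧ GenPos S ∧ (planeGraphs S).card = n}

/-- The plane graphs on `S` with at most `m` edges. -/
def planeGraphsLE (S : Finset Pt) (m : ℝ) : Finset (Finset (Sym2 Pt)) :=
  (planeGraphs S).filter fun G => (G.card : ℝ) ≤ m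

/-- `ĥv_{x,m}(S)`: the average of `v_x(G)` over a uniformly random plane graph
on `S` with at most `m` edges. -/
def hvxLE (S : Finset Pt) (m : ℝ) : ℝ :=
  (∑ G ∈ planeGraphsLE S m, (vx S G : ℝ)) / (planeGraphsLE S m).card

/-- `G` has no vertex (point of `S`) of degree smaller than `i`. -/
def MinDegGe (S : Finset Pt) (G : Finset (Sym2 Pt)) (i : ℕ) : Prop :=
  ∀ p ∈ S, i ≤ vingDeg G p

/-- The plane graphs on `S` with no vertex of degree smaller than `i`. -/
def planeGraphsDeg (S : Finset Pt) (i : ℕ) : Finset (Finset (Sym2 Pt)) :=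
  (planeGraphs S).filter fun G => MinDegGe S G i

/-- The plane graphs on `S` with at most `m` edges and no vertex of degree
smaller than `i`. -/
def planeGraphsLEDeg (S : Finset Pt) (m : ℝ) (i : ℕ) : Finset (Finset (Sym2 Pt)) :=
  (planeGraphs S).filter fun G => (G.card : ℝ) ≤ m ∧ MinDegGe S G i

/-- `ĥv_{x,m}(S,i)`: the average of `v_x(G)` over a uniformly random plane graph
on `S` with at most `m` edges and no vertex of degree smaller than `i`. -/
def hvxLEDeg (S : Finset Pt) (m : ℝ) (i : ℕ) : ℝ :=
  (∑ G ∈ planeGraphsLEDeg S m i, (vx S G : ℝ)) / (planeGraphsLEDeg S m i).card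

/-- `pg(N, i)`: the maximum, over sets `S` of `N` points in general position, of
the number of plane graphs on `S` with no vertex of degree smaller than `i`. -/
def pgMaxDeg (N i : ℕ) : ℕ :=
  sSup {n : ℕ | ∃ S : Finset Pt, S.card = N ∧ GenPos S ∧ (planeGraphsDeg S i).card = n}

/-- The underlying abstract graph of `G` on the vertex set `S`. -/
def abstractGraph (S : Finset Pt) (G : Finset (Sym2 Pt)) :
    SimpleGraph (S : Set Pt) :=
  SimpleGraph.induce (S : Set Pt) (SimpleGraph.fromEdgeSet (G : Set (Sym2 Pt)))

/-- The connected plane graphs on `S`. -/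
def connPlaneGraphs (S : Finset Pt) : Finset (Finset (Sym2 Pt)) :=
  (planeGraphs S).filter fun G => (abstractGraph S G).Connected

/-- The underlying abstract graph of `G` is bi-connected (2-vertex-connected):
it is connected and remains connected after deletion of any single vertex. -/
def Biconnected (S : Finset Pt) (G : Finset (Sym2 Pt)) : Prop :=
  (abstractGraph S G).Connected ∧
    ∀ v ∈ S, (SimpleGraph.induce ((S : Set Pt) \ {v})
      (SimpleGraph.fromEdgeSet (G : Set (Sym2 Pt)))).Connected

/-- The bi-connected plane graphs on `S`. -/
def biconnPlaneGraphs (S : Finset Pt) : Finset (Finset (Sym2 Pt)) :=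
  (planeGraphs S).filter (Biconnected S)

/-- `G` is a `k`-quasi-plane graph on `S`: a straight-edge graph on `S`
(crossings allowed) with no `k` pairwise crossing edges. -/
def IsQuasiPlane (k : ℕ) (S : Finset Pt) (G : Finset (Sym2 Pt)) : Prop :=
  (∀ e ∈ G, ¬ e.IsDiag ∧ ∀ p ∈ e, p ∈ S) ∧
    ¬ ∃ T ⊆ G, T.card = k ∧ ∀ e ∈ T, ∀ f ∈ T, e ≠ f → EdgesCross e f

/-- The (finite) collection of all `k`-quasi-plane graphs on `S`. -/
def qpGraphs (k : ℕ) (S : Finset Pt) : Finset (Finset (Sym2 Pt)) :=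
  S.sym2.powerset.filter (IsQuasiPlane k S)

/-- The ving `(p, G)` is an x-ving of the `k`-quasi-plane graph `G`: no straight
edge from `p` to another point of `S` can be added to `G` without violating
`k`-quasi-planarity. -/
def IsXVingQP (k : ℕ) (S : Finset Pt) (G : Finset (Sym2 Pt)) (p : Pt) : Prop :=
  ∀ q ∈ S, q ≠ p → s(p, q) ∉ G → ¬ IsQuasiPlane k S (insert s(p, q) G)

/-- `v_x(G)` for a `k`-quasi-plane graph `G`. -/
def vxQP (k : ℕ) (S : Finset Pt) (G : Finset (Sym2 Pt)) : ℕ :=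
  (S.filter (IsXVingQP k S G)).card

/-- `ĥv_x^k(S)`: the average of `v_x(G)` over a uniformly random `k`-quasi-plane
graph on `S`. -/
def hvxQP (k : ℕ) (S : Finset Pt) : ℝ :=
  (∑ G ∈ qpGraphs k S, (vxQP k S G : ℝ)) / (qpGraphs k S).card

/-- `qp_k(N)`: the maximum number of `k`-quasi-plane graphs over all sets of `N`
points in general position. -/
def qpMax (k N : ℕ) : ℕ :=
  sSup {n : ℕ | ∃ S : Finset Pt, S.card = N ∧ GenPos S ∧ (qpGraphs k S).card = n}

/-- The value at parameter `s` of the affine function on `[0, 1]` with end values `a` and `b`. -/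
def lerp (a b s : ℝ) : ℝ := (1 - s) * a + s * b

lemma lerp_swap (a b s : ℝ) : lerp b a (1 - s) = lerp a b s := by
  unfold lerp; ring

lemma exists_lerp_eq {a b k s₀ s₁ : ℝ} (h : s₀ < s₁) (h₀ : k < lerp a b s₀)
    (h₁ : lerp a b s₁ ≤ k) : ∃ s, s₀ < s ∧ s ≤ s₁ ∧ lerp a b s = k := by
  have hc : ContinuousOn (fun s => lerp a b s) (Set.Icc s₀ s₁) := by
    unfold lerp; fun_prop
  obtain ⟨s, hs, hk⟩ := intermediate_value_Icc' h.le hc ⟨h₁, h₀.le⟩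
  refine ⟨s, lt_of_le_of_ne hs.1 ?_, hs.2, hk⟩
  rintro rfl
  exact h₀.ne' hk

lemma lerp_neg (a b s : ℝ) : lerp (-a) (-b) s = -lerp a b s := by
  unfold lerp; ring

lemma lerp_sub (a b c d s : ℝ) : lerp (a - c) (b - d) s = lerp a b s - lerp c d s := by
  unfold lerp; ring

lemma lerp_pos_of_nonpos {a b s₀ s₁ s : ℝ} (h : s₀ < s₁) (hs : s₁ ≤ s)
    (h₀ : lerp a b s₀ ≤ 0) (h₁ : 0 < lerp a b s₁) : 0 < lerp a b s := by
  unfold lerp at *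
  have : 0 < b - a := by
    by_contra hba
    nlinarith
  nlinarith

lemma lerp_pos_of_nonpos' {a b s₀ s₁ s : ℝ} (h : s₁ < s₀) (hs : s ≤ s₁)
    (h₀ : lerp a b s₀ ≤ 0) (h₁ : 0 < lerp a b s₁) : 0 < lerp a b s := by
  unfold lerp at *
  have : b - a < 0 := by
    by_contra hba
    nlinarith
  nlinarith

lemma lerp_le_of_between {a b k s₀ s₁ s : ℝ} (h₀ : s₀ ≤ s) (h₁ : s ≤ s₁)
    (hk₀ : lerp a b s₀ ≤ k) (hk₁ : lerp a b s₁ ≤ k) : lerp a b s ≤ k := by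
  unfold lerp at *
  rcases le_total a b with h | h <;> nlinarith

/-- A segment that descends from a point of the open region `0 < y`, `0 < A`, `0 < B` has to leave
the region through one of its sides. -/
lemma descending_exit {yc yd Ac Ad Bc Bd s₀ h : ℝ} (hs₀ : s₀ < 1)
    (hy : lerp yc yd s₀ = h) (hh : 0 < h) (hle : yd ≤ yc)
    (hA : 0 < lerp Ac Ad s₀) (hB : 0 < lerp Bc Bd s₀)
    (hd : 0 < yd → 0 ≤ Ad → 0 ≤ Bd → False)
    (he : ∀ s, s₀ < s → s ≤ 1 → lerp yc yd s = 0 → 0 < lerp Ac Ad s → 0 < lerp Bc Bd s → False)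
    (hf : ∀ s, s₀ < s → s ≤ 1 → lerp Ac Ad s = 0 → 0 ≤ lerp yc yd s → lerp yc yd s ≤ h → False)
    (hg : ∀ s, s₀ < s → s ≤ 1 → lerp Bc Bd s = 0 → 0 ≤ lerp yc yd s → lerp yc yd s ≤ h → False) :
    False := by
  have anti : ∀ s t, s ≤ t → lerp yc yd t ≤ lerp yc yd s := by
    intro s t hst; unfold lerp; nlinarith
  have one : ∀ a b : ℝ, lerp a b 1 = b := by intro a b; unfold lerp; ring
  obtain ⟨s', h1, h2, h3, h4⟩ : ∃ s', s₀ < s' ∧ s' ≤ 1 ∧ 0 ≤ lerp yc yd s' ∧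
      (lerp Ac Ad s' ≤ 0 ∨ lerp Bc Bd s' ≤ 0) := by
    by_cases hyd : 0 < yd
    · refine ⟨1, hs₀, le_rfl, by rw [one]; exact hyd.le, ?_⟩
      rw [one, one]
      by_contra hcon
      push Not at hcon
      exact hd hyd hcon.1.le hcon.2.le
    · obtain ⟨s, h1, h2, h3⟩ := exists_lerp_eq (k := 0) hs₀ (by rw [hy]; exact hh)
        (by rw [one]; exact not_lt.mp hyd)
      refine ⟨s, h1, h2, h3.ge, ?_⟩
      by_contra hcon
      push Not at hcon
      exact he s h1 h2 h3 hcon.1 hcon.2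
  rcases h4 with h4 | h4
  · obtain ⟨s, g1, g2, g3⟩ := exists_lerp_eq h1 hA h4
    exact hf s g1 (g2.trans h2) g3 (h3.trans (anti _ _ g2)) (hy ▸ anti _ _ g1.le)
  · obtain ⟨s, g1, g2, g3⟩ := exists_lerp_eq h1 hB h4
    exact hg s g1 (g2.trans h2) g3 (h3.trans (anti _ _ g2)) (hy ▸ anti _ _ g1.le)

lemma wedge_exit_side {Ac Ad Bc Bd yc yd k s₀ : ℝ} (h0 : 0 < s₀) (hs₀ : s₀ < 1)
    (hA : 0 < lerp Ac Ad s₀) (hB : 0 < lerp Bc Bd s₀) (hy : lerp yc yd s₀ ≤ k)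
    (hd : yd ≤ k → 0 < Ad → 0 < Bd → False)
    (htop : ∀ s, 0 < s → s < 1 → lerp yc yd s = k → 0 < lerp Ac Ad s → 0 < lerp Bc Bd s → False) :
    ∃ s, s₀ < s ∧ s ≤ 1 ∧ lerp yc yd s ≤ k ∧ (lerp Ac Ad s ≤ 0 ∨ lerp Bc Bd s ≤ 0) := by
  have one : ∀ a b : ℝ, lerp a b 1 = b := by intro a b; unfold lerp; ring
  by_cases hyd : yd ≤ k
  · refine ⟨1, hs₀, le_rfl, by rw [one]; exact hyd, ?_⟩
    rw [one, one]
    by_contra hcon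
    push Not at hcon
    exact hd hyd hcon.1 hcon.2
  · have hlt : lerp yc yd s₀ < k :=
      lt_of_le_of_ne hy fun h => htop s₀ h0 hs₀ h hA hB
    obtain ⟨s, h1, h2, h3⟩ := exists_lerp_eq (a := -yc) (b := -yd) (k := -k) hs₀
      (by rw [lerp_neg]; linarith) (by rw [one]; linarith)
    rw [lerp_neg, neg_inj] at h3
    have h2' : s < 1 := lt_of_le_of_ne h2 (by
      rintro rfl
      rw [one] at h3
      exact hyd h3.le)
    refine ⟨s, h1, h2, h3.le, ?_⟩
    by_contra hcon
    push Not at hcon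
    exact htop s (h0.trans h1) h2' h3 hcon.1 hcon.2

lemma wedge_crossing {Ac Ad Bc Bd yc yd k s₀ s₁ s₂ : ℝ} (h1 : s₁ < s₀) (h2 : s₀ < s₂)
    (h0 : 0 ≤ s₁) (h3 : s₂ ≤ 1)
    (hA : 0 < lerp Ac Ad s₀) (hB : 0 < lerp Bc Bd s₀)
    (hy1 : lerp yc yd s₁ ≤ k) (hy2 : lerp yc yd s₂ ≤ k)
    (hA2 : lerp Ac Ad s₂ ≤ 0) (hB1 : lerp Bc Bd s₁ ≤ 0) :
    ∃ s, 0 < s ∧ s < 1 ∧ lerp Ac Ad s = lerp Bc Bd s ∧ 0 < lerp Ac Ad s ∧ lerp yc yd s ≤ k := by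
  have hB2 := lerp_pos_of_nonpos h1 h2.le hB1 hB
  have hA1 := lerp_pos_of_nonpos' h2 h1.le hA2 hA
  obtain ⟨s, g1, g2, g3⟩ := exists_lerp_eq (a := Ac - Bc) (b := Ad - Bd) (k := 0) (h1.trans h2)
    (by rw [lerp_sub]; linarith) (by rw [lerp_sub]; linarith)
  have g2' : s < s₂ := lt_of_le_of_ne g2 (by
    rintro rfl
    rw [lerp_sub] at g3
    linarith)
  rw [lerp_sub, sub_eq_zero] at g3
  refine ⟨s, h0.trans_lt g1, g2'.trans_le h3, g3, ?_, lerp_le_of_between g1.le g2 hy1 hy2⟩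
  rcases le_total s s₀ with h | h
  · exact lerp_pos_of_nonpos' h2 h hA2 hA
  · rw [g3]
    exact lerp_pos_of_nonpos h1 h hB1 hB

/-- A segment whose endpoints lie outside the triangle `0 < A`, `0 < B`, `y ≤ k`, which does not
leave it through its top side and does not meet its median line, misses the triangle. -/
lemma wedge_avoid {Ac Ad Bc Bd yc yd k s₀ : ℝ} (h0 : 0 < s₀) (hs₀ : s₀ < 1)
    (hA : 0 < lerp Ac Ad s₀) (hB : 0 < lerp Bc Bd s₀) (hy : lerp yc yd s₀ ≤ k)
    (hc : yc ≤ k → 0 < Ac → 0 < Bc → False)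
    (hd : yd ≤ k → 0 < Ad → 0 < Bd → False)
    (htop : ∀ s, 0 < s → s < 1 → lerp yc yd s = k → 0 < lerp Ac Ad s → 0 < lerp Bc Bd s → False)
    (hmid : ∀ s, 0 < s → s < 1 → lerp Ac Ad s = lerp Bc Bd s → 0 < lerp Ac Ad s →
      lerp yc yd s ≤ k → False) : False := by
  obtain ⟨s₂, h1, h2, h3, h4⟩ := wedge_exit_side h0 hs₀ hA hB hy hd htop
  obtain ⟨t, g1, g2, g3, g4⟩ := wedge_exit_side (Ac := Ad) (Ad := Ac) (Bc := Bd) (Bd := Bc)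
    (yc := yd) (yd := yc) (s₀ := 1 - s₀) (k := k) (by linarith) (by linarith)
    (by rwa [lerp_swap]) (by rwa [lerp_swap]) (by rwa [lerp_swap]) hc (by
      intro s hs hs' e1 e2 e3
      refine htop (1 - s) (by linarith) (by linarith) ?_ ?_ ?_ <;> rwa [lerp_swap])
  obtain ⟨s₁, rfl⟩ : ∃ s₁, t = 1 - s₁ := ⟨1 - t, by ring⟩
  simp only [lerp_swap] at g3 g4
  have k1 : s₁ < s₀ := by linarith
  have k2 : 0 ≤ s₁ := by linarith
  rcases h4 with h4 | h4 <;> rcases g4 with g4 | g4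
  · exact absurd (lerp_pos_of_nonpos k1 h1.le g4 hA) (not_lt.mpr h4)
  · obtain ⟨s, e1, e2, e3, e4, e5⟩ := wedge_crossing k1 h1 k2 h2 hA hB g3 h3 h4 g4
    exact hmid s e1 e2 e3 e4 e5
  · obtain ⟨s, e1, e2, e3, e4, e5⟩ := wedge_crossing k1 h1 k2 h2 hB hA g3 h3 h4 g4
    exact hmid s e1 e2 e3.symm (e3 ▸ e4) e5
  · exact absurd (lerp_pos_of_nonpos k1 h1.le g4 hB) (not_lt.mpr h4)

/-- Two real functions forming an affine coordinate system of the plane. -/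
structure IsChart (x y : Pt → ℝ) : Prop where
  x_lerp : ∀ a b s, x ((1 - s) • a + s • b) = lerp (x a) (x b) s
  y_lerp : ∀ a b s, y ((1 - s) • a + s • b) = lerp (y a) (y b) s
  inj : ∀ a b, x a = x b → y a = y b → a = b

lemma IsChart.neg {x y : Pt → ℝ} (h : IsChart x y) : IsChart (fun r => -x r) y where
  x_lerp a b s := by simp only [h.x_lerp, lerp_neg]
  y_lerp := h.y_lerp
  inj a b h1 h2 := h.inj a b (neg_inj.mp h1) h2

lemma IsChart.shear {x y : Pt → ℝ} (h : IsChart x y) (m c : ℝ) :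
    IsChart x (fun r => y r - (c + m * x r)) where
  x_lerp := h.x_lerp
  y_lerp a b s := by simp only [h.x_lerp, h.y_lerp]; unfold lerp; ring
  inj a b h1 h2 := h.inj a b h1 (by simp only [h1] at h2; linarith)

lemma edgesCross_mk {a b c d : Pt} :
    EdgesCross s(a, b) s(c, d) ↔ (openSegment ℝ a b ∩ openSegment ℝ c d).Nonempty := by
  constructor
  · rintro ⟨a', b', c', d', h1, h2, h⟩
    rw [Sym2.eq_iff] at h1 h2
    rcases h1 with ⟨rfl, rfl⟩ | ⟨rfl, rfl⟩ <;> rcases h2 with ⟨rfl, rfl⟩ | ⟨rfl, rfl⟩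
    · exact h
    · rwa [openSegment_symm ℝ c d]
    · rwa [openSegment_symm ℝ a b]
    · rwa [openSegment_symm ℝ a b, openSegment_symm ℝ c d]
  · intro h
    exact ⟨a, b, c, d, rfl, rfl, h⟩

lemma edgesCross_comm {e f : Sym2 Pt} : EdgesCross e f ↔ EdgesCross f e := by
  constructor <;>
  · rintro ⟨a, b, c, d, h1, h2, h⟩
    exact ⟨c, d, a, b, h2, h1, by rwa [Set.inter_comm]⟩

lemma mem_openSegment_iff {a b r : Pt} :
    r ∈ openSegment ℝ a b ↔ ∃ s : ℝ, 0 < s ∧ s < 1 ∧ r = (1 - s) • a + s • b := by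
  constructor
  · rintro ⟨s, t, hs, ht, hst, rfl⟩
    obtain rfl : s = 1 - t := by linarith
    exact ⟨t, ht, by linarith, rfl⟩
  · rintro ⟨s, hs, hs', rfl⟩
    exact ⟨1 - s, s, by linarith, hs, by ring, rfl⟩

lemma IsChart.edgesCross_iff {x y : Pt → ℝ} (h : IsChart x y) {a b c d : Pt} :
    EdgesCross s(a, b) s(c, d) ↔ ∃ s t : ℝ, 0 < s ∧ s < 1 ∧ 0 < t ∧ t < 1 ∧
      lerp (x a) (x b) s = lerp (x c) (x d) t ∧ lerp (y a) (y b) s = lerp (y c) (y d) t := by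
  rw [edgesCross_mk]
  constructor
  · rintro ⟨r, h1, h2⟩
    obtain ⟨s, hs, hs', rfl⟩ := mem_openSegment_iff.mp h1
    obtain ⟨t, ht, ht', hr⟩ := mem_openSegment_iff.mp h2
    refine ⟨s, t, hs, hs', ht, ht', ?_, ?_⟩
    · rw [← h.x_lerp, ← h.x_lerp, hr]
    · rw [← h.y_lerp, ← h.y_lerp, hr]
  · rintro ⟨s, t, hs, hs', ht, ht', h1, h2⟩
    rw [← h.x_lerp, ← h.x_lerp] at h1
    rw [← h.y_lerp, ← h.y_lerp] at h2
    exact ⟨_, mem_openSegment_iff.mpr ⟨s, hs, hs', rfl⟩,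
      mem_openSegment_iff.mpr ⟨t, ht, ht', h.inj _ _ h1 h2⟩⟩

/-- In a set in general position, points with vanishing orientation determinant coincide. -/
lemma IsChart.eq_or_eq_or_eq {x y : Pt → ℝ} (h : IsChart x y) {S : Finset Pt} (hS : GenPos S)
    {a b c : Pt} (ha : a ∈ S) (hb : b ∈ S) (hc : c ∈ S)
    (hdet : (x b - x a) * (y c - y a) = (x c - x a) * (y b - y a)) :
    a = b ∨ a = c ∨ b = c := by
  by_contra hcon
  push Not at hcon
  obtain ⟨hab, hac, hbc⟩ := hcon
  refine hS a ha b hb c hc hab hac hbc ?_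
  have key : ∃ s : ℝ, c = (1 - s) • a + s • b := by
    by_cases hx : x b - x a = 0
    · have hy : y b - y a ≠ 0 := by
        intro hy
        exact hab (h.inj a b (by linarith) (by linarith))
      refine ⟨(y c - y a) / (y b - y a), h.inj _ _ ?_ ?_⟩
      · rw [h.x_lerp]
        unfold lerp
        rw [hx, zero_mul, eq_comm, mul_eq_zero, or_iff_left hy] at hdet
        have e1 : x b = x a := by linarith
        have e2 : x c = x a := by linarith
        rw [e1, e2]; ring
      · rw [h.y_lerp]
        unfold lerp
        field_simp
        ring
    · refine ⟨(x c - x a) / (x b - x a), h.inj _ _ ?_ ?_⟩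
      · rw [h.x_lerp]
        unfold lerp
        field_simp
        ring
      · rw [h.y_lerp]
        unfold lerp
        field_simp
        linarith
  obtain ⟨s, hs⟩ := key
  rw [collinear_iff_of_mem (p₀ := a) (by simp)]
  refine ⟨b - a, ?_⟩
  intro r hr
  simp only [Set.mem_insert_iff, Set.mem_singleton_iff] at hr
  rcases hr with rfl | rfl | rfl
  · exact ⟨0, by simp⟩
  · exact ⟨1, by simp⟩
  · refine ⟨s, ?_⟩
    rw [hs, vadd_eq_add]
    module

lemma isChart_standard : IsChart Prod.fst Prod.snd where
  x_lerp a b s := by simp [lerp]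
  y_lerp a b s := by simp [lerp]
  inj a b := Prod.ext

lemma IsPlaneGraph.ne {S : Finset Pt} {T : Finset (Sym2 Pt)} (hT : IsPlaneGraph S T) {a b : Pt}
    (h : s(a, b) ∈ T) : a ≠ b := fun hab => (hT.1 _ h).1 (by simpa using hab)

lemma IsPlaneGraph.left_mem {S : Finset Pt} {T : Finset (Sym2 Pt)} (hT : IsPlaneGraph S T)
    {a b : Pt} (h : s(a, b) ∈ T) : a ∈ S := (hT.1 _ h).2 a (by simp)

lemma IsPlaneGraph.right_mem {S : Finset Pt} {T : Finset (Sym2 Pt)} (hT : IsPlaneGraph S T)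
    {a b : Pt} (h : s(a, b) ∈ T) : b ∈ S := (hT.1 _ h).2 b (by simp)

lemma IsPlaneGraph.eq_of_cross {S : Finset Pt} {T : Finset (Sym2 Pt)} (hT : IsPlaneGraph S T)
    {e f : Sym2 Pt} (he : e ∈ T) (hf : f ∈ T) (h : EdgesCross e f) : e = f := by
  by_contra hne
  exact hT.2 e he f hf hne h

section EdgeBound

variable {S : Finset Pt} {T : Finset (Sym2 Pt)} {x y : Pt → ℝ}

/-- Let `uw` be the lowest edge that leaves `u` to the right above the horizontal axis. An edge
with a point below the line `uw` cannot meet that line below the point `w`. -/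
lemma not_exit_lowest_edge (hxy : IsChart x y) (hS : GenPos S) (hT : IsPlaneGraph S T)
    {u w c d : Pt} {α s₀ h : ℝ} (huw : s(u, w) ∈ T) (hcd : s(c, d) ∈ T) (hu : y u = 0)
    (hα : 0 < α) (hw : y w = α * (x w - x u)) (hh : h < y w) (h0 : 0 < s₀)
    (hA : 0 < lerp (α * (x c - x u) - y c) (α * (x d - x u) - y d) s₀)
    (hy : 0 < lerp (y c) (y d) s₀)
    (hlow : ∀ w', s(u, w') ∈ T → x u < x w' → 0 < y w' →
      α * (x w' - x u) ≤ y w') :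
    ∀ s, s₀ < s → s ≤ 1 → lerp (α * (x c - x u) - y c) (α * (x d - x u) - y d) s = 0 →
      0 ≤ lerp (y c) (y d) s → lerp (y c) (y d) s ≤ h → False := by
  intro s hs hs1 hAs hys hysh
  have huS := hT.left_mem huw
  have hwS := hT.right_mem huw
  have hcS := hT.left_mem hcd
  have hdS := hT.right_mem hcd
  have hne : s(c, d) ≠ s(u, w) := by
    intro heq
    rw [Sym2.eq_iff] at heq
    rcases heq with ⟨rfl, rfl⟩ | ⟨rfl, rfl⟩ <;> simp [lerp, hu, hw] at hA
  have hx : α * (lerp (x c) (x d) s - x u) = lerp (y c) (y d) s := by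
    unfold lerp at hAs ⊢
    linarith
  rcases eq_or_lt_of_le hys with h0y | hypos
  · have hxu : lerp (x c) (x d) s = x u := by
      rw [← h0y] at hx
      rcases mul_eq_zero.mp hx with h | h <;> linarith
    rcases eq_or_lt_of_le hs1 with rfl | hs1
    · have e1 : x d = x u := by simpa [lerp] using hxu
      have e2 : y d = y u := by rw [hu]; simpa [lerp] using h0y.symm
      obtain rfl := hxy.inj _ _ e1 e2
      have k1 : 0 < 1 - s₀ := by linarith
      have k2 : 0 < y c := by
        simp only [lerp, hu, mul_zero, add_zero] at hy
        exact pos_of_mul_pos_right hy k1.le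
      have k3 : y c < α * (x c - x d) := by
        simp only [lerp, hu, sub_self, mul_zero, add_zero] at hA
        linarith [pos_of_mul_pos_right hA k1.le]
      have k4 : x d < x c := by
        by_contra hcon
        nlinarith
      exact absurd (hlow c (by rwa [Sym2.eq_swap]) k4 k2) (not_le.mpr k3)
    · have k : c = d ∨ c = u ∨ d = u := by
        refine hxy.eq_or_eq_or_eq hS hcS hdS huS ?_
        rw [← hxu, hu, h0y]
        unfold lerp
        ring
      rcases k with rfl | rfl | rfl
      · exact hT.ne hcd rfl
      · have e1 : x d = x c := by
          unfold lerp at hxu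
          have : s * (x d - x c) = 0 := by linarith
          rcases mul_eq_zero.mp this with h | h <;> linarith
        have e2 : y d = y c := by
          unfold lerp at h0y
          have : s * (y d - y c) = 0 := by rw [hu] at h0y ⊢; linarith
          rcases mul_eq_zero.mp this with h | h <;> linarith
        exact hT.ne hcd (hxy.inj _ _ e1.symm e2.symm)
      · have e1 : x c = x d := by
          unfold lerp at hxu
          have : (1 - s) * (x c - x d) = 0 := by linarith
          rcases mul_eq_zero.mp this with h | h <;> linarith
        have e2 : y c = y d := by
          unfold lerp at h0y
          have : (1 - s) * (y c - y d) = 0 := by rw [hu] at h0y ⊢; linarith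
          rcases mul_eq_zero.mp this with h | h <;> linarith
        exact hT.ne hcd (hxy.inj _ _ e1 e2)
  · rcases eq_or_lt_of_le hs1 with rfl | hs1
    · have e1 : lerp (x c) (x d) 1 = x d := by simp [lerp]
      have e2 : lerp (y c) (y d) 1 = y d := by simp [lerp]
      rw [e1, e2] at hx
      rw [e2] at hypos hysh
      rcases hxy.eq_or_eq_or_eq hS huS hwS hdS (by rw [hu, hw, ← hx]; ring) with rfl | rfl | rfl
      · exact hT.ne huw rfl
      · exact hypos.ne' hu
      · exact absurd hysh (not_le.mpr hh)
    · refine hne (hT.eq_of_cross hcd huw (hxy.edgesCross_iff.mpr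
        ⟨s, lerp (y c) (y d) s / y w, h0.trans hs, hs1, ?_, ?_, ?_, ?_⟩))
      · exact div_pos hypos (by linarith)
      · rw [div_lt_one (by linarith)]
        linarith
      · have hw0 : y w ≠ 0 := by linarith
        have hxw : α * (x w - x u) ≠ 0 := by rwa [← hw]
        have e : lerp (x c) (x d) s = x u + lerp (y c) (y d) s / α := by
          field_simp
          linarith
        rw [e, hw]
        have : x w - x u ≠ 0 := right_ne_zero_of_mul hxw
        unfold lerp
        field_simp
        ring
      · have hw0 : y w ≠ 0 := by linarith
        rw [hu]
        unfold lerp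
        field_simp
        ring

lemma exists_lowest_edge {u w : Pt} (hT : IsPlaneGraph S T) (huw : s(u, w) ∈ T)
    (hx : x u < x w) (hy : 0 < y w) :
    ∃ w₀ α, s(u, w₀) ∈ T ∧ x u < x w₀ ∧ 0 < α ∧ y w₀ = α * (x w₀ - x u) ∧
      ∀ w', s(u, w') ∈ T → x u < x w' → 0 < y w' → α * (x w' - x u) ≤ y w' := by
  obtain ⟨w₀, h0, hmin⟩ := (S.filter fun w' => s(u, w') ∈ T ∧ x u < x w' ∧ 0 < y w').exists_min_image
    (fun w' => y w' / (x w' - x u)) ⟨w, Finset.mem_filter.mpr ⟨hT.right_mem huw, huw, hx, hy⟩⟩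
  obtain ⟨-, h1, h2, h3⟩ := Finset.mem_filter.mp h0
  have hpos : 0 < x w₀ - x u := by linarith
  refine ⟨w₀, y w₀ / (x w₀ - x u), h1, h2, div_pos h3 hpos, by field_simp, ?_⟩
  intro w' k1 k2 k3
  have := hmin w' (Finset.mem_filter.mpr ⟨hT.right_mem k1, k1, k2, k3⟩)
  rwa [le_div_iff₀ (by linarith)] at this

/-- If the horizontal edge `uv` is neither the topmost edge to the right at `u` nor the topmost
edge to the left at `v`, then some point sees it vertically from above. -/
lemma exists_vertically_visible (hxy : IsChart x y) (hS : GenPos S) (hT : IsPlaneGraph S T)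
    {u v w z : Pt} (huv : s(u, v) ∈ T) (hlt : x u < x v) (hu : y u = 0) (hv : y v = 0)
    (huw : s(u, w) ∈ T) (hxw : x u < x w) (hyw : 0 < y w)
    (hvz : s(v, z) ∈ T) (hxz : x z < x v) (hyz : 0 < y z) :
    ∃ m ∈ S, x u < x m ∧ x m < x v ∧ 0 < y m ∧
      ∀ c d, s(c, d) ∈ T → ∀ s, 0 < s → s < 1 → lerp (x c) (x d) s = x m →
        lerp (y c) (y d) s < y m → lerp (y c) (y d) s ≤ 0 := by
  obtain ⟨w, α, huw, hxw, hα, hw, hlow⟩ := exists_lowest_edge hT huw hxw hyw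
  obtain ⟨z, β, hvz, hxz, hβ, hz, hlow'⟩ :=
    exists_lowest_edge (x := fun r => -x r) hT hvz (neg_lt_neg hxz) hyz
  have hxz' : x z < x v := by linarith
  have hyw : 0 < y w := by rw [hw]; exact mul_pos hα (by linarith)
  have hyz : 0 < y z := by rw [hz]; exact mul_pos hβ (by linarith)
  have hz' : y z = β * (x v - x z) := by rw [hz]; ring
  set R := S.filter fun r => 0 < y r ∧ y r ≤ α * (x r - x u) ∧ y r ≤ β * (x v - x r) with hR
  have hwz : w ∈ R ∨ z ∈ R := by
    by_contra hcon
    push Not at hcon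
    obtain ⟨h1, h2⟩ := hcon
    simp only [hR, Finset.mem_filter, not_and, not_le] at h1 h2
    have h1' := h1 (hT.right_mem huw) hyw hw.le
    have h2' : α * (x z - x u) < y z := by
      by_contra hcon
      exact (h2 (hT.right_mem hvz) hyz (not_lt.mp hcon)).not_ge hz'.le
    clear h1 h2
    set a := x w - x u with ha
    set b := x v - x z with hb
    set l := x v - x u with hl
    have ha0 : 0 < a := by linarith
    have hb0 : 0 < b := by linarith
    have hl0 : 0 < l := by linarith
    have h1 : β * (l - a) < α * a := by
      rwa [hw, show x v - x w = l - a by rw [ha, hl]; ring] at h1'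
    have h2 : α * (l - b) < β * b := by
      rwa [hz', show x z - x u = l - b by rw [hb, hl]; ring] at h2'
    have hab : 0 < α + β := by linarith
    have hne : s(u, w) ≠ s(v, z) := by
      intro heq
      rw [Sym2.eq_iff] at heq
      rcases heq with ⟨rfl, rfl⟩ | ⟨rfl, rfl⟩ <;> linarith
    refine hne (hT.eq_of_cross huw hvz (hxy.edgesCross_iff.mpr
      ⟨β * l / ((α + β) * a), α * l / ((α + β) * b), by positivity, ?_, by positivity, ?_, ?_, ?_⟩))
    · rw [div_lt_one (by positivity)]; linarith
    · rw [div_lt_one (by positivity)]; linarith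
    · have e1 : x w = x u + a := by rw [ha]; ring
      have e2 : x z = x u + l - b := by rw [hb, hl]; ring
      have e3 : x v = x u + l := by rw [hl]; ring
      rw [e1, e2, e3]
      unfold lerp
      field_simp
      ring
    · rw [hu, hv, hw, hz']
      unfold lerp
      field_simp
      ring
  obtain ⟨m, hm, hmin⟩ := R.exists_min_image y (hwz.elim (fun h => ⟨_, h⟩) fun h => ⟨_, h⟩)
  obtain ⟨hmS, hm0, hmα, hmβ⟩ : m ∈ S ∧ 0 < y m ∧ y m ≤ α * (x m - x u) ∧
      y m ≤ β * (x v - x m) := by simpa [hR] using hm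
  have hum : x u < x m := by
    by_contra hcon
    nlinarith
  have hmv : x m < x v := by
    by_contra hcon
    nlinarith
  have hmw : y m ≤ y w := by
    by_cases h : w ∈ R
    · exact hmin w h
    · have h1 : β * (x v - x w) < y w := by
        by_contra hcon
        exact h (Finset.mem_filter.mpr ⟨hT.right_mem huw, hyw, hw.le, not_lt.mp hcon⟩)
      by_contra hcon
      have : x w < x m := by
        by_contra hcon
        nlinarith
      nlinarith
  have hmz : y m ≤ y z := by
    by_cases h : z ∈ R
    · exact hmin z h
    · have h1 : α * (x z - x u) < y z := by
        by_contra hcon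
        exact h (Finset.mem_filter.mpr ⟨hT.right_mem hvz, hyz, not_lt.mp hcon, hz'.le⟩)
      by_contra hcon
      have : x m < x z := by
        by_contra hcon
        nlinarith
      nlinarith
  have key : ∀ c d, s(c, d) ∈ T → ∀ s, 0 < s → s < 1 → lerp (x c) (x d) s = x m →
        lerp (y c) (y d) s < y m → y d ≤ y c → lerp (y c) (y d) s ≤ 0 := by
    intro c d hcd s₀ hs0 hs1 hxm hym hdc
    by_contra hpos
    push Not at hpos
    set h := lerp (y c) (y d) s₀ with hh
    have hdh : y d ≤ h := by rw [hh]; unfold lerp; nlinarith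
    have hA : 0 < lerp (α * (x c - x u) - y c) (α * (x d - x u) - y d) s₀ := by
      have : lerp (α * (x c - x u) - y c) (α * (x d - x u) - y d) s₀ =
          α * (lerp (x c) (x d) s₀ - x u) - h := by rw [hh]; unfold lerp; ring
      rw [this, hxm]; linarith
    have hB : 0 < lerp (β * (-x c - -x v) - y c) (β * (-x d - -x v) - y d) s₀ := by
      have : lerp (β * (-x c - -x v) - y c) (β * (-x d - -x v) - y d) s₀ =
          β * (x v - lerp (x c) (x d) s₀) - h := by rw [hh]; unfold lerp; ring
      rw [this, hxm]; linarith
    refine descending_exit (yc := y c) (yd := y d) hs1 hh.symm hpos hdc hA hB ?_ ?_ ?_ ?_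
    · intro k1 k2 k3
      refine absurd (hmin d (Finset.mem_filter.mpr ⟨hT.right_mem hcd, k1, by linarith, by linarith⟩))
        (by linarith)
    · intro s k1 k2 k3 k4 k5
      have k4' : x u < lerp (x c) (x d) s := by
        have : lerp (α * (x c - x u) - y c) (α * (x d - x u) - y d) s =
          α * (lerp (x c) (x d) s - x u) - lerp (y c) (y d) s := by unfold lerp; ring
        rw [this, k3, sub_zero] at k4
        linarith [pos_of_mul_pos_right k4 hα.le]
      have k5' : lerp (x c) (x d) s < x v := by
        have : lerp (β * (-x c - -x v) - y c) (β * (-x d - -x v) - y d) s =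
          β * (x v - lerp (x c) (x d) s) - lerp (y c) (y d) s := by unfold lerp; ring
        rw [this, k3, sub_zero] at k5
        linarith [pos_of_mul_pos_right k5 hβ.le]
      rcases eq_or_lt_of_le k2 with rfl | k2
      · have e1 : lerp (x c) (x d) 1 = x d := by simp [lerp]
        have e2 : lerp (y c) (y d) 1 = y d := by simp [lerp]
        rw [e1] at k4' k5'
        rw [e2] at k3
        rcases hxy.eq_or_eq_or_eq hS (hT.left_mem huv) (hT.right_mem huv) (hT.right_mem hcd)
          (by rw [hu, hv, k3]; ring) with rfl | rfl | rfl <;> linarith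
      · have hl : 0 < x v - x u := by linarith
        have := hT.eq_of_cross hcd huv (hxy.edgesCross_iff.mpr
          ⟨s, (lerp (x c) (x d) s - x u) / (x v - x u), hs0.trans k1, k2,
            div_pos (by linarith) hl, by rw [div_lt_one hl]; linarith, by
              generalize lerp (x c) (x d) s = X
              unfold lerp
              field_simp
              ring, by rw [k3, hu, hv]; simp [lerp]⟩)
        rw [Sym2.eq_iff] at this
        rcases this with ⟨rfl, rfl⟩ | ⟨rfl, rfl⟩ <;> rw [hh, hu, hv] at hpos <;>
          simp [lerp] at hpos
    · exact not_exit_lowest_edge hxy hS hT huw hcd hu hα hw (by linarith) hs0 hA (hh ▸ hpos) hlow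
    · exact not_exit_lowest_edge hxy.neg hS hT hvz hcd hv hβ hz (by linarith) hs0 hB (hh ▸ hpos) hlow'
  refine ⟨m, hmS, hum, hmv, hm0, ?_⟩
  intro c d hcd s h0 h1 hx hy
  rcases le_total (y d) (y c) with h | h
  · exact key c d hcd s h0 h1 hx hy h
  · have := key d c (by rwa [Sym2.eq_swap]) (1 - s) (by linarith) (by linarith)
      (by rwa [lerp_swap]) (by rwa [lerp_swap]) h
    rwa [lerp_swap] at this

/-- The edge `e` is charged to the point `m`: it is the topmost edge to the right at `m`, the
topmost edge to the left at `m`, or the highest edge vertically below `m`. -/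
def Charged (T : Finset (Sym2 Pt)) (x y : Pt → ℝ) (e : Sym2 Pt) (i : Fin 3 × Pt) : Prop :=
  ∃ u v, e = s(u, v) ∧ x u < x v ∧
    ((i.1 = 0 ∧ i.2 = u ∧ ∀ w, s(u, w) ∈ T → x u < x w →
        (x v - x u) * (y w - y u) ≤ (x w - x u) * (y v - y u)) ∨
      (i.1 = 1 ∧ i.2 = v ∧ ∀ z, s(v, z) ∈ T → x z < x v →
        (x v - x u) * (y z - y u) ≤ (x z - x u) * (y v - y u)) ∨
      (i.1 = 2 ∧ ∃ s, 0 < s ∧ s < 1 ∧ lerp (x u) (x v) s = x i.2 ∧ lerp (y u) (y v) s < y i.2 ∧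
        ∀ c d, s(c, d) ∈ T → ∀ t, 0 < t → t < 1 → lerp (x c) (x d) t = x i.2 →
          lerp (y c) (y d) t < y i.2 → lerp (y c) (y d) t ≤ lerp (y u) (y v) s))

lemma Charged.unique (hxy : IsChart x y) (hS : GenPos S) (hT : IsPlaneGraph S T)
    {e f : Sym2 Pt} (he : e ∈ T) (hf : f ∈ T) {i : Fin 3 × Pt} (h1 : Charged T x y e i)
    (h2 : Charged T x y f i) : e = f := by
  obtain ⟨j, m⟩ := i
  obtain ⟨u, v, rfl, huv, h1⟩ := h1
  obtain ⟨u', v', rfl, huv', h2⟩ := h2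
  rcases h1 with ⟨rfl, rfl, h1⟩ | ⟨rfl, rfl, h1⟩ | ⟨rfl, s, hs0, hs1, hxs, hys, h1⟩
  · rcases h2 with ⟨-, rfl, h2⟩ | ⟨h, -⟩ | ⟨h, -⟩
    · have := h1 v' hf huv'
      have := h2 v he huv
      rcases hxy.eq_or_eq_or_eq hS (hT.left_mem he) (hT.right_mem he) (hT.right_mem hf)
        (by linarith) with h | rfl | rfl
      · exact absurd h (hT.ne he)
      · exact absurd rfl (hT.ne hf)
      · rfl
    · simp at h
    · simp at h
  · rcases h2 with ⟨h, -⟩ | ⟨-, rfl, h2⟩ | ⟨h, -⟩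
    · simp at h
    · have := h1 u' (by rwa [Sym2.eq_swap]) huv'
      have := h2 u (by rwa [Sym2.eq_swap]) huv
      rcases hxy.eq_or_eq_or_eq hS (hT.left_mem he) (hT.right_mem he) (hT.left_mem hf)
        (by linarith) with h | rfl | h
      · exact absurd h (hT.ne he)
      · rfl
      · exact absurd h.symm (hT.ne hf)
    · simp at h
  · rcases h2 with ⟨h, -⟩ | ⟨h, -⟩ | ⟨-, t, ht0, ht1, hxt, hyt, h2⟩
    · simp at h
    · simp at h
    · have e1 := h1 u' v' hf t ht0 ht1 hxt hyt
      have e2 := h2 u v he s hs0 hs1 hxs hys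
      exact hT.eq_of_cross he hf (hxy.edgesCross_iff.mpr
        ⟨s, t, hs0, hs1, ht0, ht1, hxs.trans hxt.symm, le_antisymm e2 e1⟩)

lemma exists_charged (hxy : IsChart x y) (hS : GenPos S) (hT : IsPlaneGraph S T)
    (hinj : Set.InjOn x S) {e : Sym2 Pt} (he : e ∈ T) :
    ∃ i ∈ (Finset.univ : Finset (Fin 3)) ×ˢ S, Charged T x y e i := by
  obtain ⟨u, v, rfl, hlt⟩ : ∃ u v, e = s(u, v) ∧ x u < x v := by
    induction e with | _ a b
    rcases lt_trichotomy (x a) (x b) with h | h | h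
    · exact ⟨a, b, rfl, h⟩
    · exact absurd (hinj (hT.left_mem he) (hT.right_mem he) h) (hT.ne he)
    · exact ⟨b, a, Sym2.eq_swap, h⟩
  by_contra hcon
  push Not at hcon
  have hl : 0 < x v - x u := by linarith
  have h0 : ∃ w, s(u, w) ∈ T ∧ x u < x w ∧
      (x w - x u) * (y v - y u) < (x v - x u) * (y w - y u) := by
    by_contra h
    push Not at h
    exact hcon (0, u) (by simpa using hT.left_mem he) ⟨u, v, rfl, hlt, Or.inl ⟨rfl, rfl, h⟩⟩
  have h1 : ∃ z, s(v, z) ∈ T ∧ x z < x v ∧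
      (x z - x u) * (y v - y u) < (x v - x u) * (y z - y u) := by
    by_contra h
    push Not at h
    exact hcon (1, v) (by simpa using hT.right_mem he)
      ⟨u, v, rfl, hlt, Or.inr (Or.inl ⟨rfl, rfl, h⟩)⟩
  obtain ⟨w, hw1, hw2, hw3⟩ := h0
  obtain ⟨z, hz1, hz2, hz3⟩ := h1
  set σ := (y v - y u) / (x v - x u) with hσ
  have hσl : y v - y u = σ * (x v - x u) := by rw [hσ]; field_simp
  have hab : ∀ r, (x r - x u) * (y v - y u) < (x v - x u) * (y r - y u) →
      0 < y r - ((y u - σ * x u) + σ * x r) := by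
    intro r hr
    rw [hσl] at hr
    have : 0 < (x v - x u) * (y r - ((y u - σ * x u) + σ * x r)) := by linarith
    exact pos_of_mul_pos_right this hl.le
  obtain ⟨m, hmS, hm1, hm2, hm3, hm4⟩ := exists_vertically_visible
    (hxy.shear σ (y u - σ * x u)) hS hT he hlt (by ring) (by linarith) hw1 hw2 (hab w hw3)
    hz1 hz2 (hab z hz3)
  have hlerp : ∀ c d s, lerp (y c - ((y u - σ * x u) + σ * x c))
      (y d - ((y u - σ * x u) + σ * x d)) s =
      lerp (y c) (y d) s - ((y u - σ * x u) + σ * lerp (x c) (x d) s) := by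
    intro c d s; unfold lerp; ring
  have hxm : lerp (x u) (x v) ((x m - x u) / (x v - x u)) = x m := by
    unfold lerp; field_simp; ring
  have hym : lerp (y u) (y v) ((x m - x u) / (x v - x u)) = (y u - σ * x u) + σ * x m := by
    rw [hσ]; unfold lerp; field_simp; ring
  refine hcon (2, m) (by simpa using hmS) ⟨u, v, rfl, hlt, Or.inr (Or.inr ⟨rfl,
    (x m - x u) / (x v - x u), div_pos (by linarith) hl, ?_, hxm, ?_, ?_⟩)⟩
  · rw [div_lt_one hl]; linarith
  · simp only [hym]; linarith
  · intro c d hcd t ht0 ht1 hxt hyt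
    have := hm4 c d hcd t ht0 ht1 hxt
    simp only [hlerp, hxt] at this
    simp only at hyt
    rw [hym]
    linarith [this (by linarith)]

lemma exists_generic_chart (S : Finset Pt) : ∃ x y, IsChart x y ∧ Set.InjOn x (S : Set Pt) := by
  obtain ⟨t, ht⟩ := Infinite.exists_notMem_finset
    ((S ×ˢ S).image fun ab => -(ab.1.1 - ab.2.1) / (ab.1.2 - ab.2.2))
  refine ⟨fun r => r.1 + t * r.2, Prod.snd, ⟨?_, ?_, ?_⟩, ?_⟩
  · intro a b s; simp [lerp]; ring
  · exact isChart_standard.y_lerp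
  · intro a b h1 h2
    simp only [h2] at h1
    exact Prod.ext (by linarith) h2
  · intro a ha b hb h
    simp only at h
    by_cases h2 : a.2 = b.2
    · rw [h2] at h
      exact Prod.ext (by linarith) h2
    · refine absurd (Finset.mem_image.mpr ⟨(a, b), Finset.mem_product.mpr ⟨ha, hb⟩, ?_⟩) ht
      have : a.2 - b.2 ≠ 0 := sub_ne_zero.mpr h2
      simp only
      field_simp
      linarith

theorem IsPlaneGraph.card_le (hS : GenPos S) (hT : IsPlaneGraph S T) : T.card ≤ 3 * S.card := by
  obtain ⟨x, y, hxy, hinj⟩ := exists_generic_chart S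
  have := Finset.card_le_card_of_forall_subsingleton (Charged T x y)
    (s := T) (t := (Finset.univ : Finset (Fin 3)) ×ˢ S)
    (fun e he => exists_charged hxy hS hT hinj he)
    (fun i _ e he f hf => Charged.unique hxy hS hT he.1 hf.1 he.2 hf.2)
  simpa using this

end EdgeBound

/-- No point of `S` lies in the interior of the triangle `pab`. -/
def EmptyTriangle (S : Finset Pt) (p a b : Pt) : Prop :=
  ∀ r ∈ S, ∀ s t : ℝ, 0 < s → s < 1 → 0 < t → t < 1 → r ≠ (1 - s) • p + s • ((1 - t) • a + t • b)

lemma EmptyTriangle.symm {S : Finset Pt} {p a b : Pt} (h : EmptyTriangle S p a b) :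
    EmptyTriangle S p b a := by
  intro r hr s t hs hs' ht ht' heq
  refine h r hr s (1 - t) hs hs' (by linarith) (by linarith) ?_
  rw [heq]
  module

/-- The edges opposite to `p` in the empty triangles of `H` at `p`. -/
def link (S : Finset Pt) (p : Pt) (H : Finset (Sym2 Pt)) : Finset (Sym2 Pt) :=
  H.filter fun e => ∃ a b, e = s(a, b) ∧ s(p, a) ∈ H ∧ s(p, b) ∈ H ∧ EmptyTriangle S p a b

/-- The edges of `H` at `p`. -/
def edgesAt (p : Pt) (H : Finset (Sym2 Pt)) : Finset (Sym2 Pt) := H.filter fun e => p ∈ e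

section Link

variable {S : Finset Pt} {T : Finset (Sym2 Pt)} {x y : Pt → ℝ}

lemma no_edge_in_empty_wedge (hxy : IsChart x y) (hT : IsPlaneGraph S T)
    {u v c d : Pt} {k μ ν s₀ : ℝ} (huv : s(u, v) ∈ T) (hu : y u = k) (hv : y v = k)
    (hμ : 0 < μ) (hν : 0 < ν) (hxu : x u < 0) (hxv : 0 < x v)
    (hμk : k ≤ μ * x v) (hνk : k ≤ ν * -x u)
    (hmin : ∀ c d, s(c, d) ∈ T → ∀ s, 0 < s → s < 1 → lerp (x c) (x d) s = 0 →
      0 < lerp (y c) (y d) s → k ≤ lerp (y c) (y d) s)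
    (hempty : ∀ r ∈ S, y r ≤ k → 0 < y r - μ * x r → 0 < y r + ν * x r → False)
    (hcd : s(c, d) ∈ T) (hne : s(c, d) ≠ s(u, v)) (h0 : 0 < s₀) (h1 : s₀ < 1)
    (hk : lerp (y c) (y d) s₀ ≤ k)
    (hA : 0 < lerp (y c) (y d) s₀ - μ * lerp (x c) (x d) s₀)
    (hB : 0 < lerp (y c) (y d) s₀ + ν * lerp (x c) (x d) s₀) : False := by
  have eA : ∀ s, lerp (y c - μ * x c) (y d - μ * x d) s =
      lerp (y c) (y d) s - μ * lerp (x c) (x d) s := by intro s; unfold lerp; ring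
  have eB : ∀ s, lerp (y c + ν * x c) (y d + ν * x d) s =
      lerp (y c) (y d) s + ν * lerp (x c) (x d) s := by intro s; unfold lerp; ring
  have htop : ∀ s, 0 < s → s < 1 → lerp (y c) (y d) s = k →
      0 < lerp (y c - μ * x c) (y d - μ * x d) s →
      0 < lerp (y c + ν * x c) (y d + ν * x d) s → False := by
    intro s hs0 hs1 hy h2 h3
    rw [eA, hy] at h2
    rw [eB, hy] at h3
    have g1 : lerp (x c) (x d) s < x v := by
      by_contra hcon
      nlinarith
    have g2 : x u < lerp (x c) (x d) s := by
      by_contra hcon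
      nlinarith
    have hl : 0 < x v - x u := by linarith
    refine hne (hT.eq_of_cross hcd huv (hxy.edgesCross_iff.mpr
      ⟨s, (lerp (x c) (x d) s - x u) / (x v - x u), hs0, hs1, div_pos (by linarith) hl,
        by rw [div_lt_one hl]; linarith, ?_, ?_⟩))
    · generalize lerp (x c) (x d) s = X
      unfold lerp
      field_simp
      ring
    · rw [hy, hu, hv]
      unfold lerp
      ring
  refine wedge_avoid h0 h1 (by rwa [eA]) (by rwa [eB]) hk (hempty c (hT.left_mem hcd))
    (hempty d (hT.right_mem hcd)) htop ?_
  intro s hs0 hs1 heq hpos hyk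
  have hx : lerp (x c) (x d) s = 0 := by
    rw [eA, eB] at heq
    have : (μ + ν) * lerp (x c) (x d) s = 0 := by linarith
    exact (mul_eq_zero.mp this).resolve_left (by linarith)
  have hy : 0 < lerp (y c) (y d) s := by
    rw [eA, hx] at hpos
    linarith
  exact htop s hs0 hs1 (le_antisymm hyk (hmin c d hcd s hs0 hs1 hx hy)) hpos (heq ▸ hpos)

lemma side_mem_of_empty_wedge (hxy : IsChart x y) (hS : GenPos S) (hT : IsPlaneGraph S T)
    (hmax : ∀ a ∈ S, ∀ b ∈ S, a ≠ b → s(a, b) ∉ T → ∃ f ∈ T, EdgesCross f s(a, b))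
    {p u v b : Pt} {k μ ν : ℝ} (huv : s(u, v) ∈ T) (hu : y u = k) (hv : y v = k)
    (hμ : 0 < μ) (hν : 0 < ν) (hxu : x u < 0) (hxv : 0 < x v)
    (hμk : k ≤ μ * x v) (hνk : k ≤ ν * -x u)
    (hmin : ∀ c d, s(c, d) ∈ T → ∀ s, 0 < s → s < 1 → lerp (x c) (x d) s = 0 →
      0 < lerp (y c) (y d) s → k ≤ lerp (y c) (y d) s)
    (hempty : ∀ r ∈ S, y r ≤ k → 0 < y r - μ * x r → 0 < y r + ν * x r → False)
    (hp : p ∈ S) (hxp : x p = 0) (hyp : y p = 0) (hb : b ∈ S) (hxb : 0 < x b)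
    (hyb : y b = μ * x b) (hbk : y b ≤ k) : s(p, b) ∈ T := by
  by_contra hpb
  have hpb' : p ≠ b := by
    rintro rfl
    exact hxb.ne' hxp
  obtain ⟨f, hf, hcross⟩ := hmax p hp b hb hpb' hpb
  obtain ⟨c, d, rfl, hd⟩ : ∃ c d, f = s(c, d) ∧ 0 ≤ y d - μ * x d := by
    induction f with | _ c d
    obtain ⟨s, t, hs, hs1, ht, ht1, e1, e2⟩ := hxy.edgesCross_iff.mp hcross
    by_cases hd : 0 ≤ y d - μ * x d
    · exact ⟨c, d, rfl, hd⟩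
    · refine ⟨d, c, Sym2.eq_swap, ?_⟩
      by_contra hc
      unfold lerp at e1 e2
      rw [hxp] at e1
      rw [hyp, hyb] at e2
      have : (1 - s) * (y c - μ * x c) + s * (y d - μ * x d) = 0 := by
        linear_combination e2 - μ * e1
      nlinarith
  obtain ⟨s, t, hs, hs1, ht, ht1, e1, e2⟩ := hxy.edgesCross_iff.mp hcross
  have hx0 : lerp (x c) (x d) s = t * x b := by rw [e1, hxp]; unfold lerp; ring
  have hy0 : lerp (y c) (y d) s = t * y b := by rw [e2, hyp]; unfold lerp; ring
  have hAs : (1 - s) * (y c - μ * x c) + s * (y d - μ * x d) = 0 := by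
    unfold lerp at hx0 hy0
    rw [hyb] at hy0
    linear_combination hy0 - μ * hx0
  have hyb0 : 0 < y b := by rw [hyb]; exact mul_pos hμ hxb
  rcases eq_or_lt_of_le hd with hd | hd
  · have hc : y c - μ * x c = 0 := by
      rw [← hd, mul_zero, add_zero] at hAs
      exact (mul_eq_zero.mp hAs).resolve_left (by linarith)
    have hon : ∀ r ∈ S, y r - μ * x r = 0 → r = p ∨ r = b := by
      intro r hr h
      have : y r = μ * x r := by linarith
      rcases hxy.eq_or_eq_or_eq hS hp hb hr (by rw [hxp, hyp, hyb, this]; ring) with h | h | h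
      · exact absurd h hpb'
      · exact Or.inl h.symm
      · exact Or.inr h.symm
    rcases hon c (hT.left_mem hf) hc with rfl | rfl <;>
      rcases hon d (hT.right_mem hf) hd.symm with rfl | rfl
    · exact hT.ne hf rfl
    · exact hpb hf
    · exact hpb (by rwa [Sym2.eq_swap])
    · exact hT.ne hf rfl
  · have hne : s(c, d) ≠ s(u, v) := by
      intro heq
      have : lerp (y c) (y d) s = k := by
        rw [Sym2.eq_iff] at heq
        rcases heq with ⟨rfl, rfl⟩ | ⟨rfl, rfl⟩ <;> rw [hu, hv] <;> unfold lerp <;> ring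
      rw [hy0] at this
      nlinarith
    have h1 : ∀ᶠ r in nhdsWithin s (Set.Ioi s), lerp (y c) (y d) r < k := by
      refine ((show Continuous (lerp (y c) (y d)) by unfold lerp; fun_prop).tendsto s).eventually
        (gt_mem_nhds ?_) |>.filter_mono nhdsWithin_le_nhds
      rw [hy0]
      nlinarith
    have h2 : ∀ᶠ r in nhdsWithin s (Set.Ioi s),
        0 < lerp (y c) (y d) r + ν * lerp (x c) (x d) r := by
      refine ((show Continuous fun r => lerp (y c) (y d) r + ν * lerp (x c) (x d) r by
        unfold lerp; fun_prop).tendsto s).eventually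
        (lt_mem_nhds ?_) |>.filter_mono nhdsWithin_le_nhds
      rw [hy0, hx0]
      positivity
    have h3 : ∀ᶠ r in nhdsWithin s (Set.Ioi s), r < 1 :=
      (gt_mem_nhds hs1 : ∀ᶠ r in nhds s, r < 1).filter_mono nhdsWithin_le_nhds
    obtain ⟨r, ⟨⟨r1, r2⟩, r3⟩, r4⟩ := ((h1.and h2).and h3).and self_mem_nhdsWithin |>.exists
    have r4 : s < r := r4
    refine no_edge_in_empty_wedge hxy hT huv hu hv hμ hν hxu hxv hμk hνk hmin hempty hf hne
      (hs.trans r4) r3 r1.le ?_ r2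
    unfold lerp
    have hc : y c - μ * x c < 0 := by
      by_contra hcon
      nlinarith
    nlinarith

lemma exists_link_of_lowest (hxy : IsChart x y) (hS : GenPos S) (hT : IsPlaneGraph S T)
    (hmax : ∀ a ∈ S, ∀ b ∈ S, a ≠ b → s(a, b) ∉ T → ∃ f ∈ T, EdgesCross f s(a, b))
    {p q u v : Pt} {k : ℝ} (hp : p ∈ S) (hq : q ∈ S) (hxp : x p = 0) (hyp : y p = 0)
    (hxq : x q = 0) (hyq : y q = 1) (hk0 : 0 < k) (hk1 : k < 1)
    (huv : s(u, v) ∈ T) (hu : y u = k) (hv : y v = k) (hxu : x u < 0) (hxv : 0 < x v)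
    (hmin : ∀ c d, s(c, d) ∈ T → ∀ s, 0 < s → s < 1 → lerp (x c) (x d) s = 0 →
      0 < lerp (y c) (y d) s → k ≤ lerp (y c) (y d) s) :
    ∃ a b, s(p, a) ∈ T ∧ s(p, b) ∈ T ∧ s(a, b) ∈ T ∧ EmptyTriangle S p a b ∧
      EdgesCross s(a, b) s(p, q) := by
  have huS := hT.left_mem huv
  have hvS := hT.right_mem huv
  obtain ⟨b, hb, hbmax⟩ := (S.filter fun r => 0 < x r ∧ y r ≤ k).exists_max_image
    (fun r => y r / x r) ⟨v, Finset.mem_filter.mpr ⟨hvS, hxv, hv.le⟩⟩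
  obtain ⟨a, ha, hamax⟩ := (S.filter fun r => x r < 0 ∧ y r ≤ k).exists_max_image
    (fun r => y r / -x r) ⟨u, Finset.mem_filter.mpr ⟨huS, hxu, hu.le⟩⟩
  obtain ⟨hbS, hxb, hyb⟩ := Finset.mem_filter.mp hb
  obtain ⟨haS, hxa, hya⟩ := Finset.mem_filter.mp ha
  obtain ⟨μ, hμ⟩ : ∃ μ, μ = y b / x b := ⟨_, rfl⟩
  obtain ⟨ν, hν⟩ : ∃ ν, ν = y a / -x a := ⟨_, rfl⟩
  rw [← hμ] at hbmax
  rw [← hν] at hamax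
  have hxa' : 0 < -x a := by linarith
  have hbμ : y b = μ * x b := by rw [hμ]; field_simp
  have haν : y a = ν * -x a := by rw [hν, div_mul_cancel₀ _ hxa'.ne']
  have hμk : k ≤ μ * x v := by
    have := hbmax v (Finset.mem_filter.mpr ⟨hvS, hxv, hv.le⟩)
    rwa [hv, div_le_iff₀ hxv] at this
  have hνk : k ≤ ν * -x u := by
    have := hamax u (Finset.mem_filter.mpr ⟨huS, hxu, hu.le⟩)
    rwa [hu, div_le_iff₀ (by linarith)] at this
  have hμ0 : 0 < μ := pos_of_mul_pos_left (hk0.trans_le hμk) hxv.le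
  have hν0 : 0 < ν := pos_of_mul_pos_left (hk0.trans_le hνk) (by linarith)
  have hyb0 : 0 < y b := by rw [hbμ]; positivity
  have hya0 : 0 < y a := by rw [haν]; positivity
  have hempty : ∀ r ∈ S, y r ≤ k → 0 < y r - μ * x r → 0 < y r + ν * x r → False := by
    intro r hr h1 h2 h3
    rcases lt_trichotomy (x r) 0 with h | h | h
    · have := hamax r (Finset.mem_filter.mpr ⟨hr, h, h1⟩)
      rw [div_le_iff₀ (by linarith)] at this
      linarith
    · rcases hxy.eq_or_eq_or_eq hS hp hq hr (by rw [hxp, hxq, h]; ring) with rfl | rfl | rfl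
      · linarith
      · rw [hxp, hyp] at h2
        linarith
      · linarith
    · have := hbmax r (Finset.mem_filter.mpr ⟨hr, h, h1⟩)
      rw [div_le_iff₀ h] at this
      linarith
  have hpb : s(p, b) ∈ T := side_mem_of_empty_wedge hxy hS hT hmax huv hu hv hμ0 hν0 hxu hxv hμk
    hνk hmin hempty hp hxp hyp hbS hxb hbμ hyb
  have hpa : s(p, a) ∈ T := by
    refine side_mem_of_empty_wedge (u := v) (v := u) (μ := ν) (ν := μ) hxy.neg hS hT hmax
      (by rwa [Sym2.eq_swap]) hv hu hν0 hμ0 (by linarith) (by linarith) hνk (by linarith) ?_ ?_ hp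
      (by linarith) hyp haS hxa' haν hya
    · intro c d hcd s hs hs1 h1 h2
      rw [lerp_neg, neg_eq_zero] at h1
      exact hmin c d hcd s hs hs1 h1 h2
    · intro r hr h1 h2 h3
      exact hempty r hr h1 (by linarith) (by linarith)
  have hAa : 0 < y a - μ * x a := by nlinarith
  have hBb : 0 < y b + ν * x b := by positivity
  refine ⟨a, b, hpa, hpb, ?_, ?_, ?_⟩
  · by_contra hab
    obtain ⟨f, hf, hcross⟩ := hmax a haS b hbS (by rintro rfl; linarith) hab
    induction f with | _ c d
    obtain ⟨s, t, hs, hs1, ht, ht1, e1, e2⟩ := hxy.edgesCross_iff.mp hcross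
    by_cases hne : s(c, d) = s(u, v)
    · have hk : lerp (y c) (y d) s = k := by
        rw [Sym2.eq_iff] at hne
        rcases hne with ⟨rfl, rfl⟩ | ⟨rfl, rfl⟩ <;> rw [hu, hv] <;> unfold lerp <;> ring
      rw [hk] at e2
      unfold lerp at e2
      have hak : y a = k := le_antisymm hya (by by_contra hcon; nlinarith)
      have hbk : y b = k := le_antisymm hyb (by by_contra hcon; nlinarith)
      have hau : a = u := by
        rcases hxy.eq_or_eq_or_eq hS huS hvS haS (by rw [hu, hv, hak]; ring) with h | h | h
        · exact absurd h (hT.ne huv)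
        · exact h.symm
        · rw [h] at hxv; linarith
      have hbv : b = v := by
        rcases hxy.eq_or_eq_or_eq hS huS hvS hbS (by rw [hu, hv, hbk]; ring) with h | h | h
        · exact absurd h (hT.ne huv)
        · rw [h] at hxu; linarith
        · exact h.symm
      exact hab (by rwa [hau, hbv])
    · refine no_edge_in_empty_wedge hxy hT huv hu hv hμ0 hν0 hxu hxv hμk hνk hmin hempty hf hne
        hs hs1 ?_ ?_ ?_
      · rw [e2]; unfold lerp; nlinarith
      · have : lerp (y c) (y d) s - μ * lerp (x c) (x d) s = (1 - t) * (y a - μ * x a) := by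
          rw [e1, e2, hbμ]; unfold lerp; ring
        rw [this]
        exact mul_pos (by linarith) hAa
      · have : lerp (y c) (y d) s + ν * lerp (x c) (x d) s = t * (y b + ν * x b) := by
          rw [e1, e2, haν]; unfold lerp; ring
        rw [this]
        exact mul_pos ht hBb
  · intro r hr s t hs hs1 ht ht1 heq
    have e1 : x r = s * ((1 - t) * x a + t * x b) := by
      rw [heq, hxy.x_lerp, hxy.x_lerp, hxp]; unfold lerp; ring
    have e2 : y r = s * ((1 - t) * y a + t * y b) := by
      rw [heq, hxy.y_lerp, hxy.y_lerp, hyp]; unfold lerp; ring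
    refine hempty r hr ?_ ?_ ?_
    · have : (1 - t) * y a + t * y b ≤ k := by nlinarith
      rw [e2]
      nlinarith
    · have : y r - μ * x r = s * ((1 - t) * (y a - μ * x a)) := by
        rw [e1, e2, hbμ]; ring
      rw [this]
      exact mul_pos hs (mul_pos (by linarith) hAa)
    · have : y r + ν * x r = s * (t * (y b + ν * x b)) := by
        rw [e1, e2, haν]; ring
      rw [this]
      positivity
  · have hl : 0 < x b - x a := by linarith
    have ht0 : 0 < -x a / (x b - x a) := by positivity
    have ht1 : -x a / (x b - x a) < 1 := by rw [div_lt_one hl]; linarith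
    refine hxy.edgesCross_iff.mpr ⟨-x a / (x b - x a),
      lerp (y a) (y b) (-x a / (x b - x a)), ht0, ht1, ?_, ?_, ?_, ?_⟩
    · unfold lerp
      have := mul_pos ht0 hyb0
      have := mul_pos (sub_pos.mpr ht1) hya0
      linarith
    · unfold lerp
      nlinarith
    · rw [hxp, hxq]; unfold lerp; field_simp; ring
    · rw [hyp, hyq]; unfold lerp; ring

/-- In a maximal plane graph, every non-edge `pq` crosses an edge of the link of `p`. -/
theorem exists_link_cross (hS : GenPos S) (hT : IsPlaneGraph S T)
    (hmax : ∀ a ∈ S, ∀ b ∈ S, a ≠ b → s(a, b) ∉ T → ∃ f ∈ T, EdgesCross f s(a, b))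
    {p q : Pt} (hp : p ∈ S) (hq : q ∈ S) (hpq : p ≠ q) (hpqT : s(p, q) ∉ T) :
    ∃ a b, s(p, a) ∈ T ∧ s(p, b) ∈ T ∧ s(a, b) ∈ T ∧ EmptyTriangle S p a b ∧
      EdgesCross s(a, b) s(p, q) := by
  obtain ⟨x, y, hxy, hxp, hyp, hxq, hyq⟩ : ∃ x y : Pt → ℝ, IsChart x y ∧ x p = 0 ∧ y p = 0 ∧
      x q = 0 ∧ y q = 1 := by
    set α := q.1 - p.1 with hα
    set β := q.2 - p.2 with hβ
    have hn : α ^ 2 + β ^ 2 ≠ 0 := by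
      intro h
      have h1 : α = 0 := by nlinarith [sq_nonneg α, sq_nonneg β]
      have h2 : β = 0 := by nlinarith [sq_nonneg α, sq_nonneg β]
      exact hpq (Prod.ext (by linarith) (by linarith))
    refine ⟨fun r => α * (r.2 - p.2) - β * (r.1 - p.1),
      fun r => (α * (r.1 - p.1) + β * (r.2 - p.2)) / (α ^ 2 + β ^ 2), ⟨?_, ?_, ?_⟩,
      by simp, by simp, ?_, ?_⟩
    · intro a b s; simp [lerp]; ring
    · intro a b s; simp [lerp]; field_simp; ring
    · intro a b h1 h2
      field_simp at h2
      refine Prod.ext (mul_left_cancel₀ hn ?_) (mul_left_cancel₀ hn ?_)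
      · linear_combination α * h2 - β * h1
      · linear_combination β * h2 + α * h1
    · simp only [← hα, ← hβ]; ring
    · simp only [← hα, ← hβ]; field_simp
  have hzero : ∀ r ∈ S, x r = 0 → r = p ∨ r = q := by
    intro r hr h
    rcases hxy.eq_or_eq_or_eq hS hp hq hr (by rw [hxp, hxq, h]; ring) with h | h | h
    · exact absurd h hpq
    · exact Or.inl h.symm
    · exact Or.inr h.symm
  have hsign : ∀ c d, s(c, d) ∈ T → ∀ s, 0 < s → s < 1 → lerp (x c) (x d) s = 0 →
      x c < 0 ∧ 0 < x d ∨ x d < 0 ∧ 0 < x c := by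
    intro c d hcd s hs hs1 h
    unfold lerp at h
    rcases lt_trichotomy (x c) 0 with hc | hc | hc
    · exact Or.inl ⟨hc, by by_contra hcon; nlinarith⟩
    · have hd : x d = 0 := by
        rw [hc, mul_zero, zero_add] at h
        exact (mul_eq_zero.mp h).resolve_left hs.ne'
      exfalso
      rcases hzero c (hT.left_mem hcd) hc with rfl | rfl <;>
        rcases hzero d (hT.right_mem hcd) hd with rfl | rfl
      · exact hT.ne hcd rfl
      · exact hpqT hcd
      · exact hpqT (by rwa [Sym2.eq_swap])
      · exact hT.ne hcd rfl
    · exact Or.inr ⟨by by_contra hcon; nlinarith, hc⟩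
  have hheight : ∀ c d s, x c < 0 → 0 < x d → lerp (x c) (x d) s = 0 →
      lerp (y c) (y d) s = (x d * y c - x c * y d) / (x d - x c) := by
    intro c d s hc hd h
    have hl : x d - x c ≠ 0 := by linarith
    rw [eq_div_iff hl]
    unfold lerp at *
    linear_combination (y d - y c) * h
  set C := (S ×ˢ S).filter fun ab => s(ab.1, ab.2) ∈ T ∧ x ab.1 < 0 ∧ 0 < x ab.2 ∧
    0 < (x ab.2 * y ab.1 - x ab.1 * y ab.2) / (x ab.2 - x ab.1) with hC
  have hmem : ∀ c d s, s(c, d) ∈ T → x c < 0 → 0 < x d → lerp (x c) (x d) s = 0 →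
      0 < lerp (y c) (y d) s → (c, d) ∈ C := by
    intro c d s hcd hc hd h h0
    rw [hheight c d s hc hd h] at h0
    simp only [hC, Finset.mem_filter, Finset.mem_product]
    exact ⟨⟨hT.left_mem hcd, hT.right_mem hcd⟩, hcd, hc, hd, h0⟩
  have hmem' : ∀ c d, s(c, d) ∈ T → ∀ s, 0 < s → s < 1 → lerp (x c) (x d) s = 0 →
      0 < lerp (y c) (y d) s → ∃ ab ∈ C,
        lerp (y c) (y d) s = (x ab.2 * y ab.1 - x ab.1 * y ab.2) / (x ab.2 - x ab.1) := by
    intro c d hcd s hs hs1 h h0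
    rcases hsign c d hcd s hs hs1 h with ⟨hc, hd⟩ | ⟨hd, hc⟩
    · exact ⟨(c, d), hmem c d s hcd hc hd h h0, hheight c d s hc hd h⟩
    · rw [← lerp_swap] at h h0 ⊢
      exact ⟨(d, c), hmem d c _ (by rwa [Sym2.eq_swap]) hd hc h h0, hheight d c _ hd hc h⟩
  obtain ⟨f, hf, hcross⟩ := hmax p hp q hq hpq hpqT
  induction f with | _ c₀ d₀
  obtain ⟨s₀, t₀, hs0, hs1, ht0, ht1, e1, e2⟩ := hxy.edgesCross_iff.mp hcross
  have e1 : lerp (x c₀) (x d₀) s₀ = 0 := by rw [e1, hxp, hxq]; unfold lerp; ring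
  have e2 : lerp (y c₀) (y d₀) s₀ = t₀ := by rw [e2, hyp, hyq]; unfold lerp; ring
  obtain ⟨ab₀, hab₀, hh₀⟩ := hmem' c₀ d₀ hf s₀ hs0 hs1 e1 (by rwa [e2])
  obtain ⟨⟨u, v⟩, huvC, hmin⟩ := C.exists_min_image
    (fun ab => (x ab.2 * y ab.1 - x ab.1 * y ab.2) / (x ab.2 - x ab.1)) ⟨ab₀, hab₀⟩
  obtain ⟨-, huv, hxu, hxv, hk0⟩ := Finset.mem_filter.mp huvC
  simp only at huv hxu hxv hk0 hmin
  set k := (x v * y u - x u * y v) / (x v - x u) with hk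
  have hk1 : k < 1 := by
    have := hmin ab₀ hab₀
    rw [← hh₀, e2] at this
    linarith
  have hl : x v - x u ≠ 0 := by linarith
  refine exists_link_of_lowest (hxy.shear ((y v - y u) / (x v - x u)) 0) hS hT hmax (k := k)
    (u := u) (v := v) hp hq hxp (by rw [hxp, hyp]; ring) hxq (by rw [hxq, hyq]; ring) hk0 hk1
    huv ?_ ?_ hxu hxv ?_
  · rw [hk]; field_simp; ring
  · rw [hk]; field_simp; ring
  · intro c d hcd s hs hs1 h h0
    have e : lerp (y c - (0 + (y v - y u) / (x v - x u) * x c))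
        (y d - (0 + (y v - y u) / (x v - x u) * x d)) s = lerp (y c) (y d) s -
          (y v - y u) / (x v - x u) * lerp (x c) (x d) s := by unfold lerp; ring
    rw [e, h, mul_zero, sub_zero] at h0 ⊢
    obtain ⟨ab, hab, heq⟩ := hmem' c d hcd s hs hs1 h h0
    rw [heq]
    exact hmin ab hab

lemma not_emptyTriangle_of_between (hS : GenPos S) (hT : IsPlaneGraph S T) {p a b c : Pt}
    (hpa : s(p, a) ∈ T) (hpb : s(p, b) ∈ T) (hac : s(a, c) ∈ T)
    (h1 : 0 < (a.1 - p.1) * (b.2 - p.2) - (b.1 - p.1) * (a.2 - p.2))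
    (h2 : 0 < (a.1 - p.1) * (c.2 - p.2) - (c.1 - p.1) * (a.2 - p.2))
    (h3 : 0 < (b.1 - p.1) * (c.2 - p.2) - (c.1 - p.1) * (b.2 - p.2)) :
    ¬ EmptyTriangle S p a c := by
  intro hempty
  obtain ⟨D, hD⟩ : ∃ D, D = (a.1 - p.1) * (c.2 - p.2) - (c.1 - p.1) * (a.2 - p.2) := ⟨_, rfl⟩
  obtain ⟨X, hX⟩ : ∃ X, X = (b.1 - p.1) * (c.2 - p.2) - (c.1 - p.1) * (b.2 - p.2) := ⟨_, rfl⟩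
  obtain ⟨Y, hY⟩ : ∃ Y, Y = (a.1 - p.1) * (b.2 - p.2) - (b.1 - p.1) * (a.2 - p.2) := ⟨_, rfl⟩
  rw [← hY] at h1
  rw [← hD] at h2
  rw [← hX] at h3
  have e1 : D * (b.1 - p.1) = X * (a.1 - p.1) + Y * (c.1 - p.1) := by rw [hD, hX, hY]; ring
  have e2 : D * (b.2 - p.2) = X * (a.2 - p.2) + Y * (c.2 - p.2) := by rw [hD, hX, hY]; ring
  have hXY : 0 < X + Y := by linarith
  have ht0 : 0 < Y / (X + Y) := by positivity
  have ht1 : Y / (X + Y) < 1 := by rw [div_lt_one hXY]; linarith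
  have hb1 : b.1 = p.1 + (X * (a.1 - p.1) + Y * (c.1 - p.1)) / D := by
    field_simp; linarith
  have hb2 : b.2 = p.2 + (X * (a.2 - p.2) + Y * (c.2 - p.2)) / D := by
    field_simp; linarith
  rcases lt_trichotomy (X + Y) D with h | h | h
  · refine hempty b (hT.right_mem hpb) ((X + Y) / D) (Y / (X + Y)) (by positivity)
      (by rwa [div_lt_one h2]) ht0 ht1 (Prod.ext ?_ ?_)
    · rw [hb1]; simp; field_simp; ring
    · rw [hb2]; simp; field_simp; ring
  · rcases isChart_standard.eq_or_eq_or_eq hS (hT.left_mem hac) (hT.right_mem hac)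
      (hT.right_mem hpb) (by rw [hb1, hb2, ← h]; field_simp; ring) with rfl | rfl | rfl
    · exact hT.ne hac rfl
    · rw [hY] at h1; linarith
    · rw [hX] at h3; linarith
  · have hne : s(p, b) ≠ s(a, c) := by
      intro heq
      rw [Sym2.eq_iff] at heq
      rcases heq with ⟨rfl, rfl⟩ | ⟨rfl, rfl⟩
      · exact hT.ne hpa rfl
      · rw [hD] at h2; linarith
    refine hne (hT.eq_of_cross hpb hac (isChart_standard.edgesCross_iff.mpr
      ⟨D / (X + Y), Y / (X + Y), by positivity, by rwa [div_lt_one hXY], ht0, ht1, ?_, ?_⟩))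
    · rw [hb1]; unfold lerp; field_simp; ring
    · rw [hb2]; unfold lerp; field_simp; ring

/-- The number of link edges of `p` is at most the degree of `p`. -/
lemma card_link_le (hS : GenPos S) (hT : IsPlaneGraph S T) (p : Pt) :
    (link S p T).card ≤ vingDeg T p := by
  refine Finset.card_le_card_of_forall_subsingleton
    (fun e f => ∃ a b, e = s(a, b) ∧ f = s(p, a) ∧ s(p, b) ∈ T ∧ EmptyTriangle S p a b ∧
      0 < (a.1 - p.1) * (b.2 - p.2) - (b.1 - p.1) * (a.2 - p.2)) ?_ ?_
  · intro e he
    obtain ⟨he, a, b, rfl, ha, hb, hempty⟩ := Finset.mem_filter.mp he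
    rcases lt_trichotomy 0 ((a.1 - p.1) * (b.2 - p.2) - (b.1 - p.1) * (a.2 - p.2)) with h | h | h
    · exact ⟨s(p, a), Finset.mem_filter.mpr ⟨ha, by simp⟩, a, b, rfl, rfl, hb, hempty, h⟩
    · rcases isChart_standard.eq_or_eq_or_eq hS (hT.left_mem ha) (hT.right_mem ha)
        (hT.right_mem hb) (by linarith) with h | h | h
      · exact absurd h (hT.ne ha)
      · exact absurd h (hT.ne hb)
      · exact absurd h (hT.ne he)
    · exact ⟨s(p, b), Finset.mem_filter.mpr ⟨hb, by simp⟩, b, a, Sym2.eq_swap, rfl, ha,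
        hempty.symm, by linarith⟩
  · rintro f hf e ⟨he, a, b, rfl, rfl, hb, hempty, hdet⟩ e'
      ⟨he', a', b', rfl, haa, hb', hempty', hdet'⟩
    obtain ⟨hf, -⟩ := Finset.mem_filter.mp hf
    obtain ⟨he, -⟩ := Finset.mem_filter.mp he
    obtain ⟨he', -⟩ := Finset.mem_filter.mp he'
    obtain rfl : a = a' := Sym2.congr_right.mp haa
    rcases lt_trichotomy 0 ((b.1 - p.1) * (b'.2 - p.2) - (b'.1 - p.1) * (b.2 - p.2)) with h | h | h
    · exact absurd hempty' (not_emptyTriangle_of_between hS hT hf hb he' hdet hdet' h)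
    · rcases isChart_standard.eq_or_eq_or_eq hS (hT.left_mem hb) (hT.right_mem hb)
        (hT.right_mem hb') (by linarith) with h | h | h
      · exact absurd h (hT.ne hb)
      · exact absurd h (hT.ne hb')
      · rw [h]
    · exact absurd hempty (not_emptyTriangle_of_between hS hT hf hb' he hdet' hdet (by linarith))

end Link

section Counting

variable {S : Finset Pt} {T H : Finset (Sym2 Pt)} {p : Pt}

lemma IsPlaneGraph.subset (hT : IsPlaneGraph S T) (h : H ⊆ T) : IsPlaneGraph S H :=
  ⟨fun e he => hT.1 e (h he), fun e he f hf => hT.2 e (h he) f (h hf)⟩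

lemma mem_planeGraphs : H ∈ planeGraphs S ↔ IsPlaneGraph S H := by
  refine ⟨fun h => (Finset.mem_filter.mp h).2, fun h => Finset.mem_filter.mpr ⟨?_, h⟩⟩
  exact Finset.mem_powerset.mpr fun e he => Finset.mem_sym2_iff.mpr (h.1 e he).2

lemma GenPos.subset {S' : Finset Pt} (hS : GenPos S) (h : S' ⊆ S) : GenPos S' :=
  fun p hp q hq r hr => hS p (h hp) q (h hq) r (h hr)

lemma IsPlaneGraph.insert {a b : Pt} (hT : IsPlaneGraph S T) (ha : a ∈ S) (hb : b ∈ S)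
    (hab : a ≠ b) (h : ∀ f ∈ T, f ≠ s(a, b) → ¬ EdgesCross f s(a, b)) :
    IsPlaneGraph S (insert s(a, b) T) := by
  constructor
  · intro e he
    rcases Finset.mem_insert.mp he with rfl | he
    · refine ⟨by simpa using hab, fun r hr => ?_⟩
      rcases Sym2.mem_iff.mp hr with rfl | rfl <;> assumption
    · exact hT.1 e he
  · intro e he f hf hne
    rcases Finset.mem_insert.mp he with rfl | he <;> rcases Finset.mem_insert.mp hf with rfl | hf
    · exact absurd rfl hne
    · rw [edgesCross_comm]
      exact h f hf hne.symm
    · exact h e he hne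
    · exact hT.2 e he f hf hne

/-- Every plane graph is contained in an edge-maximal one. -/
lemma IsPlaneGraph.exists_maximal (hH : IsPlaneGraph S H) :
    ∃ T, H ⊆ T ∧ IsPlaneGraph S T ∧
      ∀ a ∈ S, ∀ b ∈ S, a ≠ b → s(a, b) ∉ T → ∃ f ∈ T, EdgesCross f s(a, b) := by
  obtain ⟨T, hHT, hT⟩ := (planeGraphs S).exists_le_maximal (mem_planeGraphs.mpr hH)
  have hTS := mem_planeGraphs.mp hT.prop
  refine ⟨T, hHT, hTS, fun a ha b hb hab hn => ?_⟩
  by_contra! hcon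
  have h := hTS.insert ha hb hab fun f hf _ => hcon f hf
  exact hn (hT.le_of_ge (mem_planeGraphs.mpr h) (Finset.subset_insert _ _)
    (Finset.mem_insert_self _ _))

lemma edgesAt_eq_of_subset (hHT : H ⊆ T) (h : edgesAt p T ⊆ H) : edgesAt p H = edgesAt p T :=
  (Finset.filter_subset_filter _ hHT).antisymm fun _ he =>
    Finset.mem_filter.mpr ⟨h he, (Finset.mem_filter.mp he).2⟩

lemma link_eq_of_subset (hHT : H ⊆ T) (h : edgesAt p T ⊆ H) (h' : link S p T ⊆ H) :
    link S p H = link S p T := by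
  ext e
  constructor <;> intro he <;> obtain ⟨he', a, b, rfl, ha, hb, hab⟩ := Finset.mem_filter.mp he
  · exact Finset.mem_filter.mpr ⟨hHT he', a, b, rfl, hHT ha, hHT hb, hab⟩
  · exact Finset.mem_filter.mpr ⟨h' he, a, b, rfl, h (Finset.mem_filter.mpr ⟨ha, by simp⟩),
      h (Finset.mem_filter.mpr ⟨hb, by simp⟩), hab⟩

/-- The edges at `p` and the link of `p` in a maximal plane graph make `p` an x-ving. -/
lemma isXVing_of_subset (hS : GenPos S) (hT : IsPlaneGraph S T)
    (hmax : ∀ a ∈ S, ∀ b ∈ S, a ≠ b → s(a, b) ∉ T → ∃ f ∈ T, EdgesCross f s(a, b))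
    (hp : p ∈ S) (h : edgesAt p T ⊆ H) (h' : link S p T ⊆ H) : IsXVing S H p := by
  intro q hq hqp hn hins
  have hpqT : s(p, q) ∉ T := fun hpq => hn (h (Finset.mem_filter.mpr ⟨hpq, by simp⟩))
  obtain ⟨a, b, ha, hb, hab, hempty, hcross⟩ := exists_link_cross hS hT hmax hp hq hqp.symm hpqT
  have habH : s(a, b) ∈ H := h' (Finset.mem_filter.mpr ⟨hab, a, b, rfl, ha, hb, hempty⟩)
  exact hins.2 _ (Finset.mem_insert_of_mem habH) _ (Finset.mem_insert_self _ _)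
    (by rintro heq; exact hpqT (heq ▸ hab)) hcross

lemma card_le_two_pow_of_union_eq {α : Type*} [DecidableEq α] {F : Finset (Finset α)}
    {A B : Finset α} (h : ∀ G ∈ F, G ∪ A = B) : F.card ≤ 2 ^ A.card := by
  rw [← Finset.card_powerset]
  refine Finset.card_le_card_of_injOn (· ∩ A)
    (fun G _ => Finset.mem_coe.mpr (Finset.mem_powerset.mpr Finset.inter_subset_right)) ?_
  intro G hG G' hG' heq
  have hu := (h G hG).trans (h G' hG').symm
  ext e
  have h1 := Finset.ext_iff.mp hu e
  have h2 := Finset.ext_iff.mp heq e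
  simp only [Finset.mem_union, Finset.mem_inter] at h1 h2
  tauto

/-- Two edges of a point set in general position that share an endpoint do not cross. -/
lemma not_edgesCross_of_common (hS : GenPos S) {q r : Pt} (hp : p ∈ S) (hq : q ∈ S) (hr : r ∈ S)
    (hpq : p ≠ q) (hpr : p ≠ r) (hqr : q ≠ r) : ¬ EdgesCross s(p, q) s(p, r) := by
  rw [isChart_standard.edgesCross_iff]
  rintro ⟨s, t, hs, -, ht, -, h1, h2⟩
  unfold lerp at h1 h2
  rcases isChart_standard.eq_or_eq_or_eq hS hp hq hr
    (mul_left_cancel₀ (mul_pos hs ht).ne' (by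
      linear_combination t * (r.2 - p.2) * h1 - t * (r.1 - p.1) * h2)) with h | h | h
  · exact hpq h
  · exact hpr h
  · exact hqr h

lemma IsXVing.subset_of_filter_eq (hS : GenPos S) (hp : p ∈ S) {H' : Finset (Sym2 Pt)}
    (hH : IsPlaneGraph S H) (hH' : IsPlaneGraph S H') (hx : IsXVing S H' p)
    (h : (H.filter fun e => p ∉ e) = H'.filter fun e => p ∉ e) : H ⊆ H' := by
  intro e he
  by_cases hpe : p ∈ e
  · obtain ⟨q, rfl⟩ := Sym2.mem_iff_exists.mp hpe
    by_contra hn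
    refine hx q (hH.right_mem he) (hH.ne he).symm hn
      (hH'.insert hp (hH.right_mem he) (hH.ne he) fun f hf hne => ?_)
    by_cases hpf : p ∈ f
    · obtain ⟨r, rfl⟩ := Sym2.mem_iff_exists.mp hpf
      exact not_edgesCross_of_common hS hp (hH'.right_mem hf) (hH.right_mem he) (hH'.ne hf)
        (hH.ne he) (by rintro rfl; exact hne rfl)
    · have hfH : f ∈ H.filter fun e => p ∉ e := h ▸ Finset.mem_filter.mpr ⟨hf, hpf⟩
      exact hH.2 f (Finset.mem_filter.mp hfH).1 _ he hne
  · have heH : e ∈ H'.filter fun e => p ∉ e := h ▸ Finset.mem_filter.mpr ⟨he, hpe⟩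
    exact (Finset.mem_filter.mp heH).1

/-- The plane graphs on `S` in which `p` is an x-ving are determined by their restriction to
`S \ {p}`. -/
lemma card_isXVing_le (hS : GenPos S) (hp : p ∈ S) :
    ((planeGraphs S).filter fun H => IsXVing S H p).card ≤ (planeGraphs (S.erase p)).card := by
  refine Finset.card_le_card_of_injOn (fun H => H.filter fun e => p ∉ e) ?_ ?_
  · intro H hH
    have hH := mem_planeGraphs.mp (Finset.mem_filter.mp hH).1
    refine Finset.mem_coe.mpr (mem_planeGraphs.mpr ⟨fun e he => ?_, (hH.subset
      (Finset.filter_subset _ _)).2⟩)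
    obtain ⟨he, hpe⟩ := Finset.mem_filter.mp he
    exact ⟨(hH.1 e he).1, fun r hr => Finset.mem_erase.mpr
      ⟨by rintro rfl; exact hpe hr, (hH.1 e he).2 r hr⟩⟩
  · intro H hH H' hH' heq
    obtain ⟨hH, hx⟩ := Finset.mem_filter.mp hH
    obtain ⟨hH', hx'⟩ := Finset.mem_filter.mp hH'
    rw [mem_planeGraphs] at hH hH'
    exact (hx'.subset_of_filter_eq hS hp hH hH' heq).antisymm
      (hx.subset_of_filter_eq hS hp hH' hH heq.symm)

lemma IsPlaneGraph.sum_vingDeg_le (hS : GenPos S) (hT : IsPlaneGraph S T) :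
    ∑ p ∈ S, vingDeg T p ≤ 6 * S.card := by
  have h : ∑ p ∈ S, vingDeg T p = ∑ e ∈ T, (S.filter fun p => p ∈ e).card :=
    Finset.sum_card_bipartiteAbove_eq_sum_card_bipartiteBelow (fun p e => p ∈ e)
  have h2 : ∀ e ∈ T, (S.filter fun p => p ∈ e).card ≤ 2 := by
    intro e _
    induction e with | h a b => ?_
    refine (Finset.card_le_card (t := {a, b}) fun r hr => ?_).trans Finset.card_le_two
    simpa using (Finset.mem_filter.mp hr).2
  have h3 := Finset.sum_le_card_nsmul T _ 2 h2
  have h4 := hT.card_le hS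
  rw [smul_eq_mul] at h3
  omega

lemma seven_sub_le (d : ℕ) : (7 : ℝ) - d ≤ 4096 * (1 / 4) ^ d := by
  rcases le_or_gt d 6 with h | h
  · interval_cases d <;> norm_num
  · have : (7 : ℝ) ≤ d := by exact_mod_cast h
    have : (0 : ℝ) < (1 / 4) ^ d := by positivity
    linarith

lemma IsPlaneGraph.card_le_sum (hS : GenPos S) (hT : IsPlaneGraph S T) :
    (S.card : ℝ) ≤ ∑ p ∈ S, 4096 * (1 / 4 : ℝ) ^ vingDeg T p := by
  have h : ((∑ p ∈ S, vingDeg T p : ℕ) : ℝ) ≤ 6 * S.card := by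
    exact_mod_cast hT.sum_vingDeg_le hS
  have h2 := Finset.sum_le_sum fun p (_ : p ∈ S) => seven_sub_le (vingDeg T p)
  rw [Finset.sum_sub_distrib, Finset.sum_const, nsmul_eq_mul] at h2
  push_cast at h
  linarith

/-- Weighted count of plane graphs by the degrees of `p` in chosen maximal extensions. -/
lemma sum_pow_vingDeg_le (hS : GenPos S) (hp : p ∈ S) {T : Finset (Sym2 Pt) → Finset (Sym2 Pt)}
    (hle : ∀ G ∈ planeGraphs S, G ⊆ T G) (hT : ∀ G ∈ planeGraphs S, IsPlaneGraph S (T G))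
    (hmax : ∀ G ∈ planeGraphs S, ∀ a ∈ S, ∀ b ∈ S, a ≠ b → s(a, b) ∉ T G →
      ∃ f ∈ T G, EdgesCross f s(a, b)) :
    ∑ G ∈ planeGraphs S, (1 / 4 : ℝ) ^ vingDeg (T G) p ≤ (planeGraphs (S.erase p)).card := by
  set Φ : Finset (Sym2 Pt) → Finset (Sym2 Pt) :=
    fun G => G ∪ (edgesAt p (T G) ∪ link S p (T G)) with hΦ
  have hsub : ∀ G ∈ planeGraphs S, Φ G ⊆ T G := fun G hG =>
    Finset.union_subset (hle G hG)
      (Finset.union_subset (Finset.filter_subset _ _) (Finset.filter_subset _ _))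
  have hat : ∀ G, edgesAt p (T G) ⊆ Φ G := fun G =>
    Finset.subset_union_left.trans Finset.subset_union_right
  have hlink : ∀ G, link S p (T G) ⊆ Φ G := fun G =>
    Finset.subset_union_right.trans Finset.subset_union_right
  have hmaps : ∀ G ∈ planeGraphs S, Φ G ∈ (planeGraphs S).filter fun H => IsXVing S H p :=
    fun G hG => Finset.mem_filter.mpr ⟨mem_planeGraphs.mpr ((hT G hG).subset (hsub G hG)),
      isXVing_of_subset hS (hT G hG) (hmax G hG) hp (hat G) (hlink G)⟩
  rw [← Finset.sum_fiberwise_of_maps_to hmaps]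
  refine le_trans ?_ (Nat.cast_le.mpr (card_isXVing_le hS hp))
  rw [Finset.card_eq_sum_ones, Nat.cast_sum]
  refine Finset.sum_le_sum fun H hH => ?_
  have hHp := mem_planeGraphs.mp (Finset.mem_filter.mp hH).1
  have hfib : ∀ G ∈ (planeGraphs S).filter (fun G => Φ G = H),
      edgesAt p (T G) = edgesAt p H ∧ link S p (T G) = link S p H ∧
        G ∪ (edgesAt p (T G) ∪ link S p (T G)) = H := by
    intro G hG
    obtain ⟨hGS, rfl⟩ := Finset.mem_filter.mp hG
    exact ⟨(edgesAt_eq_of_subset (hsub G hGS) (hat G)).symm,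
      (link_eq_of_subset (hsub G hGS) (hat G) (hlink G)).symm, rfl⟩
  have hcard : ((planeGraphs S).filter fun G => Φ G = H).card ≤ 4 ^ vingDeg H p := by
    refine (card_le_two_pow_of_union_eq (A := edgesAt p H ∪ link S p H) (B := H) ?_).trans ?_
    · intro G hG
      obtain ⟨h1, h2, h3⟩ := hfib G hG
      rwa [h1, h2] at h3
    · rw [show 4 = 2 ^ 2 from rfl, ← pow_mul]
      refine Nat.pow_le_pow_right two_pos ((Finset.card_union_le _ _).trans ?_)
      have h1 : (edgesAt p H).card = vingDeg H p := rfl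
      have h2 := card_link_le hS hHp p
      omega
  have hdeg : ∀ G ∈ (planeGraphs S).filter (fun G => Φ G = H),
      (1 / 4 : ℝ) ^ vingDeg (T G) p = (1 / 4 : ℝ) ^ vingDeg H p := fun G hG =>
    congrArg (fun A : Finset (Sym2 Pt) => (1 / 4 : ℝ) ^ A.card) (hfib G hG).1
  rw [Finset.sum_congr rfl hdeg, Finset.sum_const, nsmul_eq_mul, Nat.cast_one, one_div, inv_pow,
    ← div_eq_mul_inv, div_le_one (by positivity)]
  exact_mod_cast hcard

lemma card_mul_card_planeGraphs_le (hS : GenPos S) :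
    S.card * (planeGraphs S).card ≤ 4096 * ∑ p ∈ S, (planeGraphs (S.erase p)).card := by
  have hex : ∀ G, ∃ T, G ∈ planeGraphs S → G ⊆ T ∧ IsPlaneGraph S T ∧
      ∀ a ∈ S, ∀ b ∈ S, a ≠ b → s(a, b) ∉ T → ∃ f ∈ T, EdgesCross f s(a, b) := by
    intro G
    by_cases hG : G ∈ planeGraphs S
    · obtain ⟨T, hT⟩ := (mem_planeGraphs.mp hG).exists_maximal
      exact ⟨T, fun _ => hT⟩
    · exact ⟨∅, fun h => absurd h hG⟩
  choose T hT using hex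
  have h : ((S.card * (planeGraphs S).card : ℕ) : ℝ) ≤
      ((4096 * ∑ p ∈ S, (planeGraphs (S.erase p)).card : ℕ) : ℝ) := by
    push_cast
    calc (S.card : ℝ) * (planeGraphs S).card
        = ∑ G ∈ planeGraphs S, (S.card : ℝ) := by rw [Finset.sum_const, nsmul_eq_mul, mul_comm]
      _ ≤ ∑ G ∈ planeGraphs S, ∑ p ∈ S, 4096 * (1 / 4 : ℝ) ^ vingDeg (T G) p :=
        Finset.sum_le_sum fun G hG => (hT G hG).2.1.card_le_sum hS
      _ = 4096 * ∑ p ∈ S, ∑ G ∈ planeGraphs S, (1 / 4 : ℝ) ^ vingDeg (T G) p := by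
        rw [Finset.sum_comm, Finset.mul_sum]
        simp only [Finset.mul_sum]
      _ ≤ 4096 * ∑ p ∈ S, ((planeGraphs (S.erase p)).card : ℝ) := by
        gcongr with p hp
        exact sum_pow_vingDeg_le hS hp (fun G hG => (hT G hG).1) (fun G hG => (hT G hG).2.1)
          fun G hG => (hT G hG).2.2
  exact_mod_cast h

lemma card_planeGraphs_le : ∀ (N : ℕ) (S : Finset Pt), S.card = N → GenPos S →
    (planeGraphs S).card ≤ 4096 ^ N
  | 0, S, hN, _ => by
    obtain rfl := Finset.card_eq_zero.mp hN
    exact (Finset.card_filter_le _ _).trans (by simp)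
  | N + 1, S, hN, hS => by
    have h := card_mul_card_planeGraphs_le hS
    have h2 : ∑ p ∈ S, (planeGraphs (S.erase p)).card ≤ S.card * 4096 ^ N :=
      Finset.sum_le_card_nsmul _ _ _ fun p hp => card_planeGraphs_le N _
        (by rw [Finset.card_erase_of_mem hp, hN, Nat.add_sub_cancel])
        (hS.subset (Finset.erase_subset _ _))
    rw [hN] at h h2
    refine le_of_mul_le_mul_left ?_ N.succ_pos
    calc (N + 1) * (planeGraphs S).card ≤ 4096 * ((N + 1) * 4096 ^ N) :=
          h.trans (Nat.mul_le_mul_left _ h2)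
      _ = (N + 1) * 4096 ^ (N + 1) := by ring

end Counting

/-- Theorem 2.3. The number of plane graphs on any set of `N ≥ 1`
points in general position is at most `4096 ^ N`. -/
theorem stmt2 (N : ℕ) (hN : 1 ≤ N) (S : Finset Pt) (hS : S.card = N)
    (hgp : GenPos S) :
    (planeGraphs S).card ≤ 4096 ^ N :=
  card_planeGraphs_le N S hS hgp
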